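/- For every n ≥ 6, t₂(n, n−2) = n + 2; that is, the minimum number of edges in a 2-connected graph G on n vertices with rc₂(G) ≤ n − 2 is exactly n + 2. -/

import Mathlib

open SimpleGraph

/-- A walk is rainbow (w.r.t. an edge-colouring `col`) if its edges receive
pairwise distinct colours. -/
def IsRainbowWalk {V α : Type*} {G : SimpleGraph V} {u v : V} (col : Sym2 V → α)
    (p : G.Walk u v) : Prop :=
  (p.edges.map col).Nodup

/-- An edge-colouring is rainbow 2-connected if every two distinct vertices are
connected by two internally vertex-disjoint rainbow paths. -/
def RainbowTwoConnectedColouring {V α : Type*} (G : SimpleGraph V) (col : Sym2 V → α) : Prop :=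
  ∀ u v : V, u ≠ v → ∃ p q : G.Walk u v, p.IsPath ∧ q.IsPath ∧ p ≠ q ∧
    IsRainbowWalk col p ∧ IsRainbowWalk col q ∧
    ∀ w : V, w ∈ p.support → w ∈ q.support → w = u ∨ w = v

/-- The rainbow 2-connection number: the least number of colours in a rainbow
2-connected colouring. -/
noncomputable def rc2 {V : Type*} (G : SimpleGraph V) : ℕ :=
  sInf {r : ℕ | ∃ col : Sym2 V → Fin r, RainbowTwoConnectedColouring G col}

/-- A graph is 2-connected if it has at least 3 vertices and deleting any single
vertex leaves a connected graph. -/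
def TwoConnected {V : Type*} [Fintype V] (G : SimpleGraph V) : Prop :=
  3 ≤ Fintype.card V ∧ ∀ v : V, (G.induce ({v}ᶜ : Set V)).Connected

/-- `t2 n r`: minimum number of edges of a 2-connected graph on `n` vertices
with rainbow 2-connection number at most `r`. -/
noncomputable def t2 (n r : ℕ) : ℕ :=
  sInf {m : ℕ | ∃ G : SimpleGraph (Fin n), TwoConnected G ∧ rc2 G ≤ r ∧ G.edgeSet.ncard = m}

/-- `s2 n r`: maximum number of edges of a 2-connected graph on `n` vertices
with rainbow 2-connection number at least `r`. -/
noncomputable def s2 (n r : ℕ) : ℕ :=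
  sSup {m : ℕ | ∃ G : SimpleGraph (Fin n), TwoConnected G ∧ r ≤ rc2 G ∧ G.edgeSet.ncard = m}

/-- `u` and `v` are joined by two internally disjoint rainbow paths. -/
def RainbowLinked {V α : Type*} (G : SimpleGraph V) (col : Sym2 V → α) (u v : V) : Prop :=
  ∃ p q : G.Walk u v, p.IsPath ∧ q.IsPath ∧ p ≠ q ∧
    IsRainbowWalk col p ∧ IsRainbowWalk col q ∧
    ∀ w : V, w ∈ p.support → w ∈ q.support → w = u ∨ w = v

section Walks

variable {V α : Type*} {G : SimpleGraph V} {col : Sym2 V → α} {u v : V}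

theorem IsRainbowWalk.reverse {p : G.Walk u v} (hp : IsRainbowWalk col p) :
    IsRainbowWalk col p.reverse := by
  unfold IsRainbowWalk at *
  rw [Walk.edges_reverse, List.map_reverse]
  exact List.nodup_reverse.2 hp

theorem RainbowLinked.symm (h : RainbowLinked G col u v) : RainbowLinked G col v u := by
  obtain ⟨p, q, hp, hq, hne, hpc, hqc, hd⟩ := h
  refine ⟨p.reverse, q.reverse, hp.reverse, hq.reverse, fun h ↦ hne ?_, hpc.reverse,
    hqc.reverse, ?_⟩
  · simpa using congrArg Walk.reverse h
  · intro w hw hw'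
    exact (hd w (by simpa using hw) (by simpa using hw')).symm

/-- `A` is the edge set of a rainbow `u`-`v` path, as far as this can be seen locally. -/
structure IsTrace (G : SimpleGraph V) (col : Sym2 V → α) (u v : V) (A : Set (Sym2 V)) : Prop where
  adj : ∀ {x y}, s(x, y) ∈ A → G.Adj x y
  rainbow : ∀ {e f}, e ∈ A → f ∈ A → col e = col f → e = f
  start : ∃ y, ∀ t, s(u, t) ∈ A ↔ t = y
  finish : ∃ y, ∀ t, s(v, t) ∈ A ↔ t = y
  internal : ∀ w, w ≠ u → w ≠ v → (∀ t, s(w, t) ∉ A) ∨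
    ∃ y z, y ≠ z ∧ ∀ t, s(w, t) ∈ A ↔ t = y ∨ t = z

theorem SimpleGraph.Walk.IsPath.isTrace {p : G.Walk u v} (hp : p.IsPath)
    (hc : IsRainbowWalk col p) (huv : u ≠ v) : IsTrace G col u v {e | e ∈ p.edges} := by
  have hnil : ¬ p.Nil := Walk.not_nil_of_ne huv
  have key : ∀ w t, s(w, t) ∈ p.edges ↔ t ∈ p.toSubgraph.neighborSet w := fun w t ↦ by
    rw [Subgraph.mem_neighborSet, Walk.adj_toSubgraph_iff_mem_edges]
  refine ⟨fun h ↦ p.adj_of_mem_edges h, fun he hf h ↦ List.inj_on_of_nodup_map hc he hf h,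
    ⟨p.snd, fun t ↦ ?_⟩, ⟨p.penultimate, fun t ↦ ?_⟩, fun w hu hv ↦ ?_⟩
  · rw [Set.mem_ofPred_eq, key, hp.neighborSet_toSubgraph_startpoint hnil, Set.mem_singleton_iff]
  · rw [Set.mem_ofPred_eq, key, hp.neighborSet_toSubgraph_endpoint hnil, Set.mem_singleton_iff]
  · by_cases hw : w ∈ p.support
    · obtain ⟨i, rfl, hi⟩ := Walk.mem_support_iff_exists_getVert.1 hw
      have h0 : i ≠ 0 := fun h ↦ hu (by simp [h])
      have h1 : i < p.length := lt_of_le_of_ne hi fun h ↦ hv (by simp [h])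
      right
      refine ⟨p.getVert (i - 1), p.getVert (i + 1), fun h ↦ ?_, fun t ↦ ?_⟩
      · have := hp.getVert_injOn (by rw [Set.mem_ofPred_eq]; lia)
          (by rw [Set.mem_ofPred_eq]; lia) h
        lia
      · rw [Set.mem_ofPred_eq, key, hp.neighborSet_toSubgraph_internal h0 h1]
        simp
    · exact Or.inl fun t ht ↦ hw (p.fst_mem_support_of_mem_edges ht)

/-- `A` and `B` are the edge sets of two internally disjoint rainbow `u`-`v` paths, as far as
this can be seen locally. -/
structure IsTracePair (G : SimpleGraph V) (col : Sym2 V → α) (u v : V)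
    (A B : Set (Sym2 V)) : Prop where
  left : IsTrace G col u v A
  right : IsTrace G col u v B
  disj : ∀ {e}, e ∈ A → e ∉ B
  internal : ∀ w, w ≠ u → w ≠ v → ∀ y z, s(w, y) ∈ A → s(w, z) ∉ B

theorem IsTracePair.swap {A B : Set (Sym2 V)} (h : IsTracePair G col u v A B) :
    IsTracePair G col u v B A :=
  ⟨h.right, h.left, fun he hf ↦ h.disj hf he, fun w hu hv y z hy hz ↦ h.internal w hu hv z y hz hy⟩

theorem IsTrace.symm {A : Set (Sym2 V)} (h : IsTrace G col u v A) : IsTrace G col v u A :=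
  ⟨h.adj, h.rainbow, h.finish, h.start, fun w hu hv ↦ h.internal w hv hu⟩

theorem IsTracePair.symm {A B : Set (Sym2 V)} (h : IsTracePair G col u v A B) :
    IsTracePair G col v u A B :=
  ⟨h.left.symm, h.right.symm, h.disj, fun w hu hv ↦ h.internal w hv hu⟩

theorem RainbowLinked.exists_isTracePair (h : RainbowLinked G col u v) (huv : u ≠ v) :
    ∃ A B, IsTracePair G col u v A B := by
  obtain ⟨p, q, hp, hq, hne, hpc, hqc, hd⟩ := h
  refine ⟨_, _, hp.isTrace hpc huv, hq.isTrace hqc huv, fun {e} ↦ ?_,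
    fun w hu hv y z hy hz ↦ ?_⟩
  · induction e using Sym2.ind with
    | _ x y =>
      intro he hf
      have hx := hd x (p.fst_mem_support_of_mem_edges he) (q.fst_mem_support_of_mem_edges hf)
      have hy := hd y (p.snd_mem_support_of_mem_edges he) (q.snd_mem_support_of_mem_edges hf)
      have hxy : x ≠ y := (p.adj_of_mem_edges he).ne
      have heq : s(x, y) = s(u, v) := by
        rw [Sym2.eq_iff]; grind
      rw [heq] at he hf
      have h1 := hp.length_eq_one_of_mem_edges he
      have h2 := hq.length_eq_one_of_mem_edges hf
      apply hne
      cases p with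
      | nil => simp at h1
      | cons a p =>
        cases q with
        | nil => simp at h2
        | cons b q =>
          simp only [Walk.length_cons, Nat.add_eq_right] at h1 h2
          obtain rfl := Walk.eq_of_length_eq_zero h1
          obtain rfl := Walk.eq_of_length_eq_zero h2
          rw [(Walk.length_eq_zero_iff.1 h1).eq_nil, (Walk.length_eq_zero_iff.1 h2).eq_nil]
  · have := hd w (p.fst_mem_support_of_mem_edges hy) (q.fst_mem_support_of_mem_edges hz)
    tauto

end Walks

section PathFn

variable {V α : Type*} {G : SimpleGraph V} {col : Sym2 V → α}

/-- `x 0, …, x m` is a path of `G`. -/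
structure IsPathFn (G : SimpleGraph V) (m : ℕ) (x : ℕ → V) : Prop where
  inj : ∀ {s t}, s ≤ m → t ≤ m → x s = x t → s = t
  adj : ∀ {s}, s < m → G.Adj (x s) (x (s + 1))

theorem IsPathFn.exists_walk {m : ℕ} {x : ℕ → V} (h : IsPathFn G m x) :
    ∃ p : G.Walk (x 0) (x m), p.IsPath ∧ p.support = (List.range (m + 1)).map x ∧
      p.edges = (List.range m).map fun k ↦ s(x k, x (k + 1)) := by
  induction m with
  | zero => exact ⟨Walk.nil, by simp, by simp, by simp⟩
  | succ m ih =>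
    obtain ⟨p, hp, hs, he⟩ := ih
      ⟨fun hs ht ↦ h.inj (by lia) (by lia), fun hs ↦ h.adj (by lia)⟩
    refine ⟨p.concat (h.adj (by lia)), hp.concat ?_ _, ?_, ?_⟩
    · rw [hs]
      simp only [List.mem_map, List.mem_range, not_exists, not_and]
      intro k hk hx
      have := h.inj (by lia) (by lia) hx
      lia
    · rw [Walk.support_concat, hs, List.range_succ (n := m + 1)]
      simp
    · rw [Walk.edges_concat, he, List.range_succ (n := m)]
      simp

/-- `x 0, …, x m, x (m + 1) = x 0` is a cycle of `G`. -/
structure IsCycleFn (G : SimpleGraph V) (m : ℕ) (x : ℕ → V) : Prop where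
  two_le : 2 ≤ m
  inj : ∀ {s t}, s ≤ m → t ≤ m → x s = x t → s = t
  adj : ∀ {s}, s ≤ m → G.Adj (x s) (x (s + 1))
  closed : x (m + 1) = x 0

theorem IsCycleFn.edge_inj {m : ℕ} {x : ℕ → V} (h : IsCycleFn G m x) {k k' : ℕ} (hk : k ≤ m)
    (hk' : k' ≤ m) (he : s(x k, x (k + 1)) = s(x k', x (k' + 1))) : k = k' := by
  have h2 := h.two_le
  rcases Sym2.eq_iff.1 he with ⟨h1, _⟩ | ⟨h1, h3⟩
  · exact h.inj hk hk' h1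
  · exfalso
    rcases Nat.lt_or_ge k m with hkm | hkm
    · have e1 := h.inj (by lia) hk' h3
      subst e1
      rcases Nat.lt_or_ge (k + 1) m with hkm' | hkm'
      · have := h.inj hk (by lia) h1
        lia
      · have : k + 1 = m := by lia
        rw [this, h.closed] at h1
        have := h.inj hk (by lia) h1
        lia
    · obtain rfl : k = m := by lia
      rw [h.closed] at h3
      obtain rfl := h.inj (by lia) hk' h3
      have := h.inj hk (by lia) h1
      lia

theorem IsCycleFn.rainbowLinked {m : ℕ} {x : ℕ → V} (h : IsCycleFn G m x) {s t : ℕ} (hst : s < t)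
    (htm : t ≤ m)
    (hin : ∀ k k', s ≤ k → k < k' → k' < t → col s(x k, x (k + 1)) ≠ col s(x k', x (k' + 1)))
    (hout : ∀ k k', k < k' → (k < s ∨ t ≤ k) → (k' < s ∨ t ≤ k') → k' ≤ m →
      col s(x k, x (k + 1)) ≠ col s(x k', x (k' + 1))) :
    RainbowLinked G col (x s) (x t) := by
  have hm := h.two_le
  have hx : IsPathFn G (t - s) fun k ↦ x (s + k) :=
    ⟨fun hs ht hh ↦ by have := h.inj (by lia) (by lia) hh; lia, fun hk ↦ h.adj (by lia)⟩
  set y : ℕ → V := fun k ↦ if k ≤ s then x (s - k) else x (m + 1 + s - k) with hy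
  obtain ⟨g, hgle, hgout, hginj, hyedge⟩ : ∃ g : ℕ → ℕ, (∀ k < m + 1 - (t - s), g k ≤ m) ∧
      (∀ k < m + 1 - (t - s), g k < s ∨ t ≤ g k) ∧
      (∀ k k', k < m + 1 - (t - s) → k' < m + 1 - (t - s) → g k = g k' → k = k') ∧
      ∀ k < m + 1 - (t - s), s(y k, y (k + 1)) = s(x (g k), x (g k + 1)) := by
    refine ⟨fun k ↦ if k < s then s - k - 1 else m + s - k, fun k hk ↦ ?_, fun k hk ↦ ?_,
      fun k k' hk hk' hkk ↦ ?_, fun k hk ↦ ?_⟩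
    · dsimp only
      split_ifs <;> lia
    · dsimp only
      split_ifs <;> lia
    · dsimp only at hkk
      split_ifs at hkk <;> lia
    · rw [hy]
      dsimp only
      split_ifs with h1 h2 h3 h4 h5 h6
      · rw [Sym2.eq_swap, show s - (k + 1) = s - k - 1 by lia, show s - k - 1 + 1 = s - k by lia]
      · lia
      · lia
      · obtain rfl : k = s := by lia
        rw [Nat.sub_self, Sym2.eq_swap, show m + k - k = m by lia, h.closed,
          show m + 1 + k - (k + 1) = m by lia]
      · lia
      · lia
      · lia
      · rw [Sym2.eq_swap, show m + 1 + s - (k + 1) = m + s - k by lia,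
          show m + s - k + 1 = m + 1 + s - k by lia]
  have hyp : IsPathFn G (m + 1 - (t - s)) y := by
    constructor
    · intro a b ha hb hab
      simp only [hy] at hab
      split_ifs at hab
      all_goals
        have := h.inj (by lia) (by lia) hab
        lia
    · intro a ha
      rw [← mem_edgeSet, hyedge a ha, mem_edgeSet]
      exact h.adj (hgle a ha)
  have hyend : y (m + 1 - (t - s)) = x t := by
    simp only [hy]
    rw [if_neg (by lia)]
    congr 1
    lia
  obtain ⟨p, hp, hps, hpe⟩ := hx.exists_walk
  obtain ⟨q, hq, hqs, hqe⟩ := hyp.exists_walk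
  have hx0 : (fun k ↦ x (s + k)) 0 = x s := rfl
  have hx1 : (fun k ↦ x (s + k)) (t - s) = x t := by simp [Nat.add_sub_cancel' hst.le]
  have hy0 : y 0 = x s := by simp [hy]
  refine ⟨p.copy hx0 hx1, q.copy hy0 hyend, by simpa using hp, by simpa using hq, ?_, ?_, ?_, ?_⟩
  · intro hh
    have h1 := congrArg Walk.support hh
    rw [Walk.support_copy, Walk.support_copy, hps, hqs] at h1
    have h2 := congrArg (fun l ↦ l[1]?) h1
    simp only [List.getElem?_map] at h2
    rw [List.getElem?_range (by lia), List.getElem?_range (by lia)] at h2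
    simp only [Option.map_some, Option.some.injEq, hy] at h2
    split_ifs at h2
    all_goals
      have := h.inj (by lia) (by lia) h2
      lia
  · unfold IsRainbowWalk
    rw [Walk.edges_copy, hpe, List.map_map]
    refine List.Nodup.map_on ?_ List.nodup_range
    intro a ha b hb hab
    rw [List.mem_range] at ha hb
    simp only [Function.comp_apply] at hab
    rcases Nat.lt_trichotomy a b with hlt | rfl | hlt
    · exact absurd hab (hin (s + a) (s + b) (by lia) (by lia) (by lia))
    · rfl
    · exact absurd hab.symm (hin (s + b) (s + a) (by lia) (by lia) (by lia))
  · unfold IsRainbowWalk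
    rw [Walk.edges_copy, hqe, List.map_map]
    refine List.Nodup.map_on ?_ List.nodup_range
    intro a ha b hb hab
    rw [List.mem_range] at ha hb
    simp only [Function.comp_apply] at hab
    rw [hyedge a ha, hyedge b hb] at hab
    rcases Nat.lt_trichotomy (g a) (g b) with hlt | heq | hlt
    · exact absurd hab (hout _ _ hlt (hgout a ha) (hgout b hb) (hgle b hb))
    · exact hginj a b ha hb heq
    · exact absurd hab.symm (hout _ _ hlt (hgout b hb) (hgout a ha) (hgle a ha))
  · intro w hw hw'
    rw [Walk.support_copy] at hw hw'
    rw [hps, List.mem_map] at hw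
    rw [hqs, List.mem_map] at hw'
    obtain ⟨a, ha, rfl⟩ := hw
    obtain ⟨b, hb, hab⟩ := hw'
    rw [List.mem_range] at ha hb
    simp only [hy] at hab
    split_ifs at hab
    · have := h.inj (by lia) (by lia) hab
      left
      congr 1
      lia
    · have := h.inj (by lia) (by lia) hab
      right
      congr 1
      lia

theorem IsCycleFn.rainbowLinked_of_injOn {m : ℕ} {x : ℕ → V} (h : IsCycleFn G m x)
    (hc : ∀ k k', k < k' → k' ≤ m → col s(x k, x (k + 1)) ≠ col s(x k', x (k' + 1)))
    {s t : ℕ} (hs : s ≤ m) (ht : t ≤ m) (hne : s ≠ t) : RainbowLinked G col (x s) (x t) := by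
  rcases lt_or_gt_of_ne hne with hlt | hlt
  · exact h.rainbowLinked hlt ht (fun k k' _ _ _ ↦ hc _ _ (by lia) (by lia))
      fun k k' _ _ _ _ ↦ hc _ _ (by lia) (by lia)
  · exact (h.rainbowLinked hlt hs (fun k k' _ _ _ ↦ hc _ _ (by lia) (by lia))
      fun k k' _ _ _ _ ↦ hc _ _ (by lia) (by lia)).symm

theorem twoConnected_of_rainbowTwoConnectedColouring [Fintype V] (hV : 3 ≤ Fintype.card V)
    (h : RainbowTwoConnectedColouring G col) : TwoConnected G := by
  refine ⟨hV, fun w ↦ ?_⟩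
  have hne : Nonempty ({w}ᶜ : Set V) := by
    have : 1 < Fintype.card V := by lia
    obtain ⟨v, hv⟩ := Fintype.exists_ne_of_one_lt_card this w
    exact ⟨⟨v, hv⟩⟩
  refine ⟨fun ⟨u, hu⟩ ⟨v, hv⟩ ↦ ?_⟩
  by_cases huv : u = v
  · subst huv; rfl
  obtain ⟨p, q, -, -, -, -, -, hd⟩ := h u v huv
  by_cases hw : w ∈ p.support
  · have hq : w ∉ q.support := fun hw' ↦ by
      rcases hd w hw hw' with rfl | rfl
      · exact hu rfl
      · exact hv rfl
    exact ⟨q.induce {w}ᶜ fun x hx (hxw : x = w) ↦ hq (hxw ▸ hx)⟩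
  · exact ⟨p.induce {w}ᶜ fun x hx (hxw : x = w) ↦ hw (hxw ▸ hx)⟩

end PathFn

section Example

/-- Adjacency of the four-thread theta graph with terminals `0` and `N`, one thread
`0, 1, …, N`, and three threads of length two through `N + 1`, `N + 2`, `N + 3`. -/
def FourThreadAdj (N a b : ℕ) : Prop :=
  (b = a + 1 ∧ b ≤ N + 1) ∨ ((a = 0 ∨ a = N) ∧ (b = N + 1 ∨ b = N + 2 ∨ b = N + 3))

/-- The colour of the edge between `lo` and `hi`, where `lo < hi`. -/
def fourThreadColor (N lo hi : ℕ) : ℕ :=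
  if hi = lo + 1 ∧ hi ≤ N + 1 then lo
  else if hi = N + 1 then N + 1
  else if hi = N + 2 then if lo = 0 then N - 1 else N + 1
  else if lo = 0 then N else 0

/-- The four-thread theta graph on `Fin (N + 4)`. -/
def fourThread (N : ℕ) : SimpleGraph (Fin (N + 4)) :=
  SimpleGraph.fromRel fun a b ↦ FourThreadAdj N a b

/-- The rainbow 2-connected colouring of the four-thread theta graph. -/
def fourThreadColouring (N : ℕ) : Sym2 (Fin (N + 4)) → Fin (N + 2) :=
  Sym2.lift ⟨fun a b ↦ Fin.ofNat (N + 2) (fourThreadColor N (min a b : Fin _) (max a b : Fin _)),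
    fun a b ↦ by dsimp only; rw [min_comm, max_comm]⟩

variable {N : ℕ}

theorem fourThreadColouring_ne (hN : 2 ≤ N) {a b c d : ℕ} (ha : a < N + 4) (hb : b < N + 4)
    (hc : c < N + 4) (hd : d < N + 4)
    (hab : FourThreadAdj N (min a b) (max a b)) (hcd : FourThreadAdj N (min c d) (max c d))
    (h : fourThreadColor N (min a b) (max a b) ≠ fourThreadColor N (min c d) (max c d)) :
    fourThreadColouring N s(Fin.ofNat _ a, Fin.ofNat _ b) ≠
      fourThreadColouring N s(Fin.ofNat _ c, Fin.ofNat _ d) := by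
  have key : ∀ a b : ℕ, a < N + 4 → b < N + 4 → FourThreadAdj N (min a b) (max a b) →
      (fourThreadColouring N s(Fin.ofNat _ a, Fin.ofNat _ b) : ℕ) =
        fourThreadColor N (min a b) (max a b) := by
    intro a b ha hb hab
    have hlt : fourThreadColor N (min a b) (max a b) < N + 2 := by
      unfold fourThreadColor
      unfold FourThreadAdj at hab
      split_ifs <;> lia
    simp only [fourThreadColouring, Sym2.lift_mk, Fin.val_ofNat, Fin.coe_min, Fin.coe_max,
      Nat.mod_eq_of_lt ha, Nat.mod_eq_of_lt hb, Nat.mod_eq_of_lt hlt]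
  intro hh
  have := congrArg Fin.val hh
  rw [key a b ha hb hab, key c d hc hd hcd] at this
  exact h this

theorem isCycleFn_fourThread {m : ℕ} {y : ℕ → ℕ} (hm : 2 ≤ m) (hlt : ∀ k ≤ m, y k < N + 4)
    (hinj : ∀ k k', k < k' → k' ≤ m → y k ≠ y k')
    (hadj : ∀ k ≤ m, FourThreadAdj N (min (y k) (y (k + 1))) (max (y k) (y (k + 1))))
    (hclosed : y (m + 1) = y 0) :
    IsCycleFn (fourThread N) m fun k ↦ Fin.ofNat (N + 4) (y k) := by
  have hlt' : ∀ k ≤ m + 1, y k < N + 4 := fun k hk ↦ by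
    rcases Nat.lt_or_ge m k with h | h
    · rw [show k = m + 1 by lia, hclosed]
      exact hlt 0 (by lia)
    · exact hlt k h
  refine ⟨hm, fun {s t} hs ht h ↦ ?_, fun {s} hs ↦ ?_, by rw [hclosed]⟩
  · have h' := congrArg Fin.val h
    rw [Fin.val_ofNat, Fin.val_ofNat, Nat.mod_eq_of_lt (hlt s hs),
      Nat.mod_eq_of_lt (hlt t ht)] at h'
    rcases Nat.lt_trichotomy s t with hlt | heq | hlt
    · exact absurd h' (hinj s t hlt ht)
    · exact heq
    · exact absurd h'.symm (hinj t s hlt hs)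
  · have h1 := hadj s hs
    rw [fourThread, fromRel_adj, Ne, Fin.ext_iff, Fin.val_ofNat, Fin.val_ofNat,
      Nat.mod_eq_of_lt (hlt s hs), Nat.mod_eq_of_lt (hlt' (s + 1) (by lia))]
    have hne : y s ≠ y (s + 1) := by
      rcases Nat.lt_or_ge s m with h | h
      · exact hinj s (s + 1) (by lia) (by lia)
      · obtain rfl : s = m := by lia
        rw [hclosed]
        exact (hinj 0 s (by lia) (by lia)).symm
    refine ⟨hne, ?_⟩
    rcases lt_or_gt_of_ne hne with h | h
    · rw [min_eq_left h.le, max_eq_right h.le] at h1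
      exact Or.inl h1
    · rw [min_eq_right h.le, max_eq_left h.le] at h1
      exact Or.inr h1

/-- A cycle of the four-thread theta graph links two of its vertices if both arcs between them
are rainbow. -/
theorem fourThread_linked (hN : 2 ≤ N) {m : ℕ} (y : ℕ → ℕ) (hm : 2 ≤ m)
    (hlt : ∀ k ≤ m, y k < N + 4) (hinj : ∀ k k', k < k' → k' ≤ m → y k ≠ y k')
    (hadj : ∀ k ≤ m, FourThreadAdj N (min (y k) (y (k + 1))) (max (y k) (y (k + 1))))
    (hclosed : y (m + 1) = y 0) {s t : ℕ} (hst : s < t) (htm : t ≤ m)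
    (hin : ∀ k k', k < k' → k' ≤ m → ((s ≤ k ∧ k' < t) ∨
        ((k < s ∨ t ≤ k) ∧ (k' < s ∨ t ≤ k'))) →
      fourThreadColor N (min (y k) (y (k + 1))) (max (y k) (y (k + 1))) ≠
        fourThreadColor N (min (y k') (y (k' + 1))) (max (y k') (y (k' + 1)))) :
    RainbowLinked (fourThread N) (fourThreadColouring N)
      (Fin.ofNat _ (y s)) (Fin.ofNat _ (y t)) := by
  have hlt' : ∀ k ≤ m + 1, y k < N + 4 := fun k hk ↦ by
    rcases Nat.lt_or_ge m k with h | h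
    · rw [show k = m + 1 by lia, hclosed]
      exact hlt 0 (by lia)
    · exact hlt k h
  have hne : ∀ k k', k < k' → k' ≤ m → ((s ≤ k ∧ k' < t) ∨
      ((k < s ∨ t ≤ k) ∧ (k' < s ∨ t ≤ k'))) →
      fourThreadColouring N s(Fin.ofNat _ (y k), Fin.ofNat _ (y (k + 1))) ≠
        fourThreadColouring N s(Fin.ofNat _ (y k'), Fin.ofNat _ (y (k' + 1))) :=
    fun k k' h1 h2 h3 ↦ fourThreadColouring_ne hN (hlt' _ (by lia)) (hlt' _ (by lia))
      (hlt' _ (by lia)) (hlt' _ (by lia)) (hadj _ (by lia)) (hadj _ (by lia)) (hin k k' h1 h2 h3)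
  exact (isCycleFn_fourThread hm hlt hinj hadj hclosed).rainbowLinked hst htm
    (fun k k' h1 h2 h3 ↦ hne k k' h2 (by lia) (Or.inl ⟨h1, h3⟩))
    fun k k' h1 h2 h3 h4 ↦ hne k k' h1 h4 (Or.inr ⟨h2, h3⟩)

/-- The cycle through the threads `0, …, N` and `0, N + i, N`. -/
def longCycle (N i k : ℕ) : ℕ := if k ≤ N then k else if k = N + 1 then N + i else 0

/-- The cycle `0, N + i, N, N + j`. -/
def shortCycle (N i j k : ℕ) : ℕ :=
  if k = 0 then 0 else if k = 1 then N + i else if k = 2 then N else if k = 3 then N + j else 0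

theorem longCycle_linked (hN : 2 ≤ N) {i : ℕ} (hi : 1 ≤ i) (hi' : i ≤ 3) {s t : ℕ} (hst : s < t)
    (htm : t ≤ N + 1) (h : i = 1 ∨ (1 ≤ s ∧ s < N ∧ t = N + 1)) :
    RainbowLinked (fourThread N) (fourThreadColouring N)
      (Fin.ofNat _ (longCycle N i s)) (Fin.ofNat _ (longCycle N i t)) := by
  refine fourThread_linked hN (m := N + 1) _ (by lia) ?_ ?_ ?_ ?_ hst htm ?_
  · intro k hk
    unfold longCycle
    split_ifs <;> lia
  · intro k k' hk hk'
    unfold longCycle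
    split_ifs <;> lia
  · intro k hk
    unfold longCycle FourThreadAdj
    split_ifs <;> lia
  · unfold longCycle
    split_ifs <;> lia
  · intro k k' hk hk' hh
    have e : ∀ k ≤ N + 1, fourThreadColor N (min (longCycle N i k) (longCycle N i (k + 1)))
        (max (longCycle N i k) (longCycle N i (k + 1))) =
        if k < N then k else if k = N then (if i = 1 then N else if i = 2 then N + 1 else 0)
        else if i = 1 then N + 1 else if i = 2 then N - 1 else N := by
      intro k hk
      have e1 : ∀ k ≤ N, longCycle N i k = k := fun k hk ↦ if_pos hk
      have e2 : longCycle N i (N + 1) = N + i := by simp [longCycle]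
      have e3 : longCycle N i (N + 1 + 1) = 0 := by simp [longCycle]
      have hcase : k < N ∨ k = N ∨ k = N + 1 := by lia
      rcases hcase with h1 | rfl | rfl
      · rw [e1 k h1.le, e1 (k + 1) h1, min_eq_left (by lia), max_eq_right (by lia),
          fourThreadColor, if_pos (by lia), if_pos h1]
      · rw [e1 k le_rfl, e2, min_eq_left (by lia), max_eq_right (by lia), fourThreadColor]
        split_ifs <;> lia
      · rw [e2, e3, min_eq_right (by lia), max_eq_left (by lia), fourThreadColor]
        split_ifs <;> lia
    rw [e k (by lia), e k' hk']
    split_ifs <;> lia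

theorem shortCycle_linked (hN : 2 ≤ N) {i j : ℕ} (hi : 1 ≤ i) (hi' : i ≤ 3) (hj : 1 ≤ j)
    (hj' : j ≤ 3) {s t : ℕ} (hst : s < t) (htm : t ≤ 3)
    (h : (i = 2 ∧ j = 3) ∨ (i = 1 ∧ j ≠ 1 ∧ s = 1 ∧ t = 3)) :
    RainbowLinked (fourThread N) (fourThreadColouring N)
      (Fin.ofNat _ (shortCycle N i j s)) (Fin.ofNat _ (shortCycle N i j t)) := by
  refine fourThread_linked hN (m := 3) _ (by lia) ?_ ?_ ?_ ?_ hst htm ?_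
  · intro k hk
    unfold shortCycle
    split_ifs <;> lia
  · intro k k' hk hk'
    unfold shortCycle
    split_ifs <;> lia
  · intro k hk
    unfold shortCycle FourThreadAdj
    split_ifs <;> lia
  · rfl
  · intro k k' hk hk' hh
    have e : ∀ k ≤ 3, fourThreadColor N (min (shortCycle N i j k) (shortCycle N i j (k + 1)))
        (max (shortCycle N i j k) (shortCycle N i j (k + 1))) =
        if k = 0 then (if i = 1 then N + 1 else if i = 2 then N - 1 else N)
        else if k = 1 then (if i = 1 then N else if i = 2 then N + 1 else 0)
        else if k = 2 then (if j = 1 then N else if j = 2 then N + 1 else 0)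
        else if j = 1 then N + 1 else if j = 2 then N - 1 else N := by
      intro k hk
      unfold shortCycle fourThreadColor
      interval_cases k <;> norm_num <;> split_ifs <;> lia
    rw [e k (by lia), e k' hk']
    split_ifs <;> lia

theorem fourThread_rainbow (hN : 2 ≤ N) :
    RainbowTwoConnectedColouring (fourThread N) (fourThreadColouring N) := by
  have key : ∀ a b : ℕ, a < b → b < N + 4 → RainbowLinked (fourThread N) (fourThreadColouring N)
      (Fin.ofNat _ a) (Fin.ofNat _ b) := by
    intro a b hab hb
    have L : ∀ i s t, 1 ≤ i → i ≤ 3 → s < t → t ≤ N + 1 →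
        (i = 1 ∨ (1 ≤ s ∧ s < N ∧ t = N + 1)) → longCycle N i s = a → longCycle N i t = b →
        RainbowLinked (fourThread N) (fourThreadColouring N) (Fin.ofNat _ a) (Fin.ofNat _ b) := by
      rintro i s t h1 h2 h3 h4 h5 rfl rfl
      exact longCycle_linked hN h1 h2 h3 h4 h5
    have S : ∀ i j s t, 1 ≤ i → i ≤ 3 → 1 ≤ j → j ≤ 3 → s < t → t ≤ 3 →
        ((i = 2 ∧ j = 3) ∨ (i = 1 ∧ j ≠ 1 ∧ s = 1 ∧ t = 3)) →
        ((shortCycle N i j s = a ∧ shortCycle N i j t = b) ∨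
          (shortCycle N i j s = b ∧ shortCycle N i j t = a)) →
        RainbowLinked (fourThread N) (fourThreadColouring N) (Fin.ofNat _ a) (Fin.ofNat _ b) := by
      rintro i j s t h1 h2 h3 h4 h5 h6 h7 (⟨rfl, rfl⟩ | ⟨rfl, rfl⟩)
      · exact shortCycle_linked hN h1 h2 h3 h4 h5 h6 h7
      · exact (shortCycle_linked hN h1 h2 h3 h4 h5 h6 h7).symm
    have hcase : b ≤ N + 1 ∨ (b = N + 2 ∨ b = N + 3) ∧ (a = 0 ∨ a = N ∨ a = N + 1 ∨
        (1 ≤ a ∧ a < N)) ∨ (b = N + 3 ∧ a = N + 2) := by lia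
    rcases hcase with hb1 | ⟨hb1, rfl | rfl | rfl | ⟨ha, ha'⟩⟩ | ⟨rfl, rfl⟩
    · refine L 1 a b (by lia) (by lia) hab hb1 (Or.inl rfl) ?_ ?_ <;> unfold longCycle <;>
        split_ifs <;> lia
    · rcases hb1 with rfl | rfl
      · exact S 2 3 0 1 (by lia) (by lia) (by lia) (by lia) (by lia) (by lia) (by lia)
          (Or.inl ⟨rfl, rfl⟩)
      · exact S 2 3 0 3 (by lia) (by lia) (by lia) (by lia) (by lia) (by lia) (by lia)
          (Or.inl ⟨rfl, rfl⟩)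
    · rcases hb1 with rfl | rfl
      · exact S 2 3 1 2 (by lia) (by lia) (by lia) (by lia) (by lia) (by lia) (by lia)
          (Or.inr ⟨rfl, rfl⟩)
      · exact S 2 3 2 3 (by lia) (by lia) (by lia) (by lia) (by lia) (by lia) (by lia)
          (Or.inl ⟨rfl, rfl⟩)
    · rcases hb1 with rfl | rfl
      · exact S 1 2 1 3 (by lia) (by lia) (by lia) (by lia) (by lia) (by lia) (by lia)
          (Or.inl ⟨rfl, rfl⟩)
      · exact S 1 3 1 3 (by lia) (by lia) (by lia) (by lia) (by lia) (by lia) (by lia)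
          (Or.inl ⟨rfl, rfl⟩)
    · refine L (b - N) a (N + 1) (by lia) (by lia) (by lia) (by lia)
        (Or.inr ⟨ha, ha', rfl⟩) ?_ ?_ <;> unfold longCycle <;> split_ifs <;> lia
    · exact S 2 3 1 3 (by lia) (by lia) (by lia) (by lia) (by lia) (by lia) (by lia)
        (Or.inl ⟨rfl, rfl⟩)
  intro u v huv
  rcases lt_or_gt_of_ne huv with h | h
  · have := key u v h v.2
    rwa [Fin.ofNat_val_eq_self, Fin.ofNat_val_eq_self] at this
  · have := (key v u h u.2).symm
    rwa [Fin.ofNat_val_eq_self, Fin.ofNat_val_eq_self] at this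

theorem fourThread_ncard_edgeSet_le : (fourThread N).edgeSet.ncard ≤ N + 6 := by
  let f : ℕ → Sym2 (Fin (N + 4)) := fun k ↦
    if k ≤ N then s(Fin.ofNat _ k, Fin.ofNat _ (k + 1))
    else if k ≤ N + 3 then s(Fin.ofNat _ 0, Fin.ofNat _ k)
    else s(Fin.ofNat _ N, Fin.ofNat _ (k - 2))
  have key : ∀ a b : Fin (N + 4), FourThreadAdj N a b → ∃ k < N + 6, f k = s(a, b) := by
    intro a b h
    have ha : Fin.ofNat (N + 4) (a : ℕ) = a := by simp
    have hb : Fin.ofNat (N + 4) (b : ℕ) = b := by simp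
    have hb' := b.2
    rw [← ha, ← hb]
    generalize (a : ℕ) = a' at *
    generalize (b : ℕ) = b' at *
    have hcase : (a' ≤ N ∧ b' = a' + 1) ∨ (a' = 0 ∧ N < b' ∧ b' ≤ N + 3) ∨
        (a' = N ∧ N + 2 ≤ b') := by
      unfold FourThreadAdj at h
      lia
    rcases hcase with ⟨h1, rfl⟩ | ⟨rfl, h1, h2⟩ | ⟨rfl, h1⟩
    · exact ⟨a', by lia, if_pos h1⟩
    · exact ⟨b', by lia, by simp only [f]; rw [if_neg (by lia), if_pos (by lia)]⟩
    · refine ⟨b' + 2, by lia, ?_⟩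
      simp only [f]
      rw [if_neg (by lia), if_neg (by lia), Nat.add_sub_cancel]
  have hsub : (fourThread N).edgeSet ⊆ ((Finset.range (N + 6)).image f : Finset _) := by
    intro e
    induction e using Sym2.ind with
    | _ a b =>
      rw [mem_edgeSet, fourThread, fromRel_adj]
      rintro ⟨-, h | h⟩
      · obtain ⟨k, hk, hf⟩ := key a b h
        exact Finset.mem_coe.2 (Finset.mem_image.2 ⟨k, Finset.mem_range.2 hk, hf⟩)
      · obtain ⟨k, hk, hf⟩ := key b a h
        exact Finset.mem_coe.2 (Finset.mem_image.2 ⟨k, Finset.mem_range.2 hk, hf.trans Sym2.eq_swap⟩)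
  calc _ ≤ _ := Set.ncard_le_ncard hsub (Finset.finite_toSet _)
    _ = _ := Set.ncard_coe_finset _
    _ ≤ _ := Finset.card_image_le
    _ = N + 6 := Finset.card_range _

end Example

section Counting

variable {r : ℕ} {l : Fin 3 → ℕ} {c : Fin 3 → ℕ → Fin r}

theorem sum_le_of_injOn_compl (D : Finset (Σ _ : Fin 3, ℕ)) (hD : D.card ≤ 2)
    (hinj : ∀ s k t k', k < l s → k' < l t → ⟨s, k⟩ ∉ D → ⟨t, k'⟩ ∉ D → c s k = c t k' →
      s = t ∧ k = k') : l 0 + l 1 + l 2 ≤ r + 2 := by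
  set U : Finset (Σ _ : Fin 3, ℕ) := Finset.univ.sigma fun t ↦ Finset.range (l t) with hU
  have hcard : U.card = l 0 + l 1 + l 2 := by
    rw [hU, Finset.card_sigma, Fin.sum_univ_three]
    simp
  have h1 : (U \ D).card ≤ (Finset.univ : Finset (Fin r)).card := by
    refine Finset.card_le_card_of_injOn (fun x ↦ c x.1 x.2) (fun _ _ ↦ Finset.mem_univ _) ?_
    rintro ⟨s, k⟩ hs ⟨t, k'⟩ ht h
    simp only [hU, Finset.mem_coe, Finset.mem_sdiff, Finset.mem_sigma, Finset.mem_univ, true_and,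
      Finset.mem_range] at hs ht
    obtain ⟨rfl, rfl⟩ := hinj s k t k' hs.1 ht.1 hs.2 ht.2 h
    rfl
  have h2 := Finset.le_card_sdiff D U
  rw [Finset.card_univ, Fintype.card_fin] at h1
  lia

/-- A colouring of the edges of three threads, the `k`-th edge of the thread `t` having
colour `c t k`, uses at most two fewer colours than there are edges, provided that it satisfies
the constraints imposed by rainbow 2-connectedness. -/
theorem sum_le_of_thread_colouring (one : ∀ s t, l s = 1 → l t = 1 → s = t)
    (pos : ∀ t, 1 ≤ l t) (long : ∃ t, 3 ≤ l t)
    (same : ∀ t k k', k < k' → k' < l t → c t k = c t k' → k = 0 ∧ k' + 1 = l t)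
    (cross : ∀ s t k k', s ≠ t → k < l s → k' < l t → c s k = c t k' →
      (k + 1 = l s ∨ k' + 1 = l t) ∧ (k = 0 ∨ k' = 0))
    (outer : ∀ t k k', k < k' → k' ≤ l t → (0 < k ∨ k' < l t) → ∃ s, s ≠ t ∧
      (∀ m m', m < l s → m' < l t → (m' < k ∨ k' ≤ m') → c s m ≠ c t m') ∧
      (∀ m m', m < m' → m' < l s → c s m ≠ c s m') ∧
      ∀ m m', m < m' → m' < l t → (m < k ∨ k' ≤ m) → (m' < k ∨ k' ≤ m') → c t m ≠ c t m') :
    l 0 + l 1 + l 2 ≤ r + 2 := by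
  have conf : ∀ s k t k', 2 ≤ l s → 2 ≤ l t → k < l s → k' < l t → c s k = c t k' →
      (s = t ∧ k = k') ∨ (k = 0 ∧ k' + 1 = l t) ∨ (k' = 0 ∧ k + 1 = l s) := by
    intro s k t k' hs ht hk hk' h
    by_cases hst : s = t
    · subst hst
      rcases Nat.lt_trichotomy k k' with h1 | h1 | h1
      · exact Or.inr (Or.inl (same s k k' h1 hk' h))
      · exact Or.inl ⟨rfl, h1⟩
      · exact Or.inr (Or.inr (same s k' k h1 hk h.symm))
    · have := cross s t k k' hst hk hk' h
      lia
  have last : ∀ s t, s ≠ t → 2 ≤ l s → 2 ≤ l t → c s (l s - 1) ≠ c t (l t - 1) := by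
    intro s t hst hs ht h
    have := cross s t _ _ hst (by lia) (by lia) h
    lia
  have third : ∀ i j s t : Fin 3, s ≠ t → i ≠ s → i ≠ t → j ≠ s → j ≠ t → i = j := by decide
  have third' : ∀ s t : Fin 3, s ≠ t → ∃ e, e ≠ s ∧ e ≠ t ∧ ∀ i, i = s ∨ i = t ∨ i = e := by
    decide
  have cardErase : ∀ j : Fin 3, (((Finset.univ.erase j).image
      fun i ↦ (⟨i, l i - 1⟩ : Σ _ : Fin 3, ℕ))).card ≤ 2 := fun j ↦
    Finset.card_image_le.trans (by simp)
  have memErase : ∀ j t k, k + 1 = l t → t ≠ j → (⟨t, k⟩ : Σ _ : Fin 3, ℕ) ∈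
      (Finset.univ.erase j).image fun i ↦ (⟨i, l i - 1⟩ : Σ _ : Fin 3, ℕ) := by
    intro j t k hk htj
    refine Finset.mem_image.2 ⟨t, by simp [htj], ?_⟩
    rw [← hk, Nat.add_sub_cancel]
  by_cases hone : ∃ e, l e = 1
  · obtain ⟨e, he⟩ := hone
    have two : ∀ t, t ≠ e → 2 ≤ l t := fun t ht ↦ by
      have := pos t
      by_contra h
      exact ht (one t e (by lia) he)
    by_cases hfree : ∃ j, j ≠ e ∧ ∀ i, i ≠ e → c i 0 ≠ c j (l j - 1)
    · obtain ⟨j, hj, hfree⟩ := hfree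
      obtain ⟨j', hj'j, hj'e, hall⟩ := third' j e hj
      refine sum_le_of_injOn_compl (c := c) {⟨e, 0⟩, ⟨j', l j' - 1⟩} Finset.card_le_two ?_
      intro s k t k' hk hk' hsD htD h
      simp only [Finset.mem_insert, Finset.mem_singleton, Sigma.mk.injEq, heq_eq_eq, not_or,
        not_and] at hsD htD
      have hse : s ≠ e := fun hse ↦ hsD.1 hse (by subst hse; lia)
      have hte : t ≠ e := fun hte ↦ htD.1 hte (by subst hte; lia)
      rcases conf s k t k' (two s hse) (two t hte) hk hk' h with h1 | ⟨rfl, h1⟩ | ⟨rfl, h1⟩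
      · exact h1
      · rcases hall t with rfl | rfl | rfl
        · exact absurd h (by rw [← Nat.eq_sub_of_add_eq h1] at hfree; exact hfree s hse)
        · exact absurd rfl hte
        · exact absurd (by lia) (htD.2 rfl)
      · rcases hall s with rfl | rfl | rfl
        · exact absurd h.symm (by rw [← Nat.eq_sub_of_add_eq h1] at hfree; exact hfree t hte)
        · exact absurd rfl hse
        · exact absurd (by lia) (hsD.2 rfl)
    · push Not at hfree
      by_cases hsep : ∀ t k, t ≠ e → k < l t → c t k ≠ c e 0
      · refine sum_le_of_injOn_compl (c := c) _ (cardErase e) ?_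
        intro s k t k' hk hk' hsD htD h
        by_cases hse : s = e
        · subst hse
          obtain rfl : k = 0 := by lia
          by_cases hte : t = s
          · subst hte
            exact ⟨rfl, by lia⟩
          · exact absurd h.symm (hsep t k' hte hk')
        · by_cases hte : t = e
          · subst hte
            obtain rfl : k' = 0 := by lia
            exact absurd h (hsep s k hse hk)
          · rcases conf s k t k' (two s hse) (two t hte) hk hk' h with h1 | ⟨_, h1⟩ | ⟨_, h1⟩
            · exact h1
            · exact absurd (memErase e t k' h1 hte) htD
            · exact absurd (memErase e s k h1 hse) hsD
      · exfalso
        push Not at hsep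
        obtain ⟨t, k, hte, hk, hke⟩ := hsep
        obtain ⟨s, hst, hse, hall⟩ := third' t e hte
        have hlt := two t hte
        have hls := two s hse
        obtain ⟨i, hie, hi⟩ := hfree t hte
        obtain ⟨j, hje, hj⟩ := hfree s hse
        obtain ⟨s₁, hs₁t, ho₁, hi₁, -⟩ := outer t 0 1 (by lia) (by lia) (by lia)
        obtain ⟨s₂, hs₂t, ho₂, hi₂, -⟩ := outer t (l t - 1) (l t) (by lia) (by lia) (by lia)
        have hs₂ : s₂ = e := by
          rcases hall s₂ with rfl | rfl | rfl
          · exact absurd rfl hs₂t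
          · rfl
          · rcases hall j with rfl | rfl | rfl
            · exact absurd hj.symm (ho₂ _ _ (by lia) (by lia) (by lia))
            · exact absurd rfl hje
            · exact absurd hj (hi₂ _ _ (by lia) (by lia))
        subst hs₂
        have hk1 : ¬ k < l t - 1 := fun hlt ↦ ho₂ 0 k (by lia) hk (Or.inl hlt) hke.symm
        rcases hall s₁ with rfl | rfl | rfl
        · exact hs₁t rfl
        · exact ho₁ 0 k (by lia) hk (by lia) hke.symm
        · rcases hall i with rfl | rfl | rfl
          · rcases hall j with rfl | rfl | rfl
            · exact last _ _ hst hls hlt (hj.symm.trans hi)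
            · exact hje rfl
            · exact hi₁ _ _ (by lia) (by lia) hj
          · exact hie rfl
          · exact ho₁ _ _ (by lia) (by lia) (by lia) hi
  · push Not at hone
    have two : ∀ t, 2 ≤ l t := fun t ↦ by
      have := pos t
      have := hone t
      lia
    by_cases hfree : ∃ j, ∀ i, c i 0 ≠ c j (l j - 1)
    · obtain ⟨j, hfree⟩ := hfree
      refine sum_le_of_injOn_compl (c := c) _ (cardErase j) ?_
      intro s k t k' hk hk' hsD htD h
      rcases conf s k t k' (two s) (two t) hk hk' h with h1 | ⟨rfl, h1⟩ | ⟨rfl, h1⟩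
      · exact h1
      · by_cases htj : t = j
        · subst htj
          exact absurd h (by rw [← Nat.eq_sub_of_add_eq h1] at hfree; exact hfree s)
        · exact absurd (memErase j t k' h1 htj) htD
      · by_cases hsj : s = j
        · subst hsj
          exact absurd h.symm (by rw [← Nat.eq_sub_of_add_eq h1] at hfree; exact hfree t)
        · exact absurd (memErase j s k h1 hsj) hsD
    · exfalso
      push Not at hfree
      obtain ⟨t, ht⟩ := long
      obtain ⟨s, hst, ho, hi, hi'⟩ := outer t 1 2 (by lia) (by lia) (by lia)
      have := two s
      obtain ⟨i, hti⟩ := hfree t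
      obtain ⟨j, hsj⟩ := hfree s
      have hit : i ≠ t := by
        rintro rfl
        exact hi' _ _ (by lia) (by lia) (by lia) (by lia) hti
      have his : i ≠ s := by
        rintro rfl
        exact ho _ _ (by lia) (by lia) (by lia) hti
      have hjs : j ≠ s := by
        rintro rfl
        exact hi _ _ (by lia) (by lia) hsj
      have hjt : j ≠ t := by
        rintro rfl
        exact ho _ _ (by lia) (by lia) (by lia) hsj.symm
      obtain rfl := third i j s t hst his hit hjs hjt
      exact last s t hst (two s) (two t) (hsj.symm.trans hti)

end Counting

section Traces

variable {V α : Type*} {G : SimpleGraph V} {col : Sym2 V → α} {u v : V} {A B : Set (Sym2 V)}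

theorem IsTrace.mem_iff_mem (h : IsTrace G col u v A) {w y z : V} (hu : w ≠ u) (hv : w ≠ v)
    (hw : ∀ t, G.Adj w t → t = y ∨ t = z) : s(w, y) ∈ A ↔ s(w, z) ∈ A := by
  rcases h.internal w hu hv with h0 | ⟨p, q, hpq, h1⟩
  · simp [h0]
  · have hp := hw p (h.adj ((h1 p).2 (Or.inl rfl)))
    have hq := hw q (h.adj ((h1 q).2 (Or.inr rfl)))
    rw [h1, h1]
    grind

/-- A path using one edge of a thread uses all of them. -/
theorem IsTrace.mem_of_thread (h : IsTrace G col u v A) {x : ℕ → V} {i j : ℕ}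
    (hx : ∀ m, i < m → m < j → x m ≠ u ∧ x m ≠ v ∧
      ∀ t, G.Adj (x m) t → t = x (m - 1) ∨ t = x (m + 1)) {m m' : ℕ} (hm : i ≤ m) (hmj : m < j)
    (hm' : i ≤ m') (hmj' : m' < j) (hA : s(x m, x (m + 1)) ∈ A) : s(x m', x (m' + 1)) ∈ A := by
  have key : ∀ d, i + d < j → (s(x (i + d), x (i + d + 1)) ∈ A ↔ s(x i, x (i + 1)) ∈ A) := by
    intro d
    induction d with
    | zero => simp
    | succ d ih =>
      intro hd
      obtain ⟨hu, hv, hw⟩ := hx (i + d + 1) (by lia) (by lia)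
      rw [← ih (by lia), ← Nat.add_assoc, ← h.mem_iff_mem hu hv hw, Nat.add_sub_cancel, Sym2.eq_swap]
  have h1 := key (m - i) (by lia)
  have h2 := key (m' - i) (by lia)
  rw [Nat.add_sub_of_le hm] at h1
  rw [Nat.add_sub_of_le hm'] at h2
  exact h2.2 (h1.1 hA)

theorem IsTracePair.mem_or_mem (h : IsTracePair G col u v A B) {y z : V}
    (hu : ∀ t, G.Adj u t → t = y ∨ t = z) :
    (s(u, y) ∈ A ∨ s(u, y) ∈ B) ∧ (s(u, z) ∈ A ∨ s(u, z) ∈ B) := by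
  obtain ⟨p, hp⟩ := h.left.start
  obtain ⟨q, hq⟩ := h.right.start
  have hpA := (hp p).2 rfl
  have hqB := (hq q).2 rfl
  have hpq : p ≠ q := fun hpq ↦ h.disj hpA (hpq ▸ hqB)
  have := hu p (h.left.adj hpA)
  have := hu q (h.right.adj hqB)
  grind

/-- Edges of a thread with an end of degree two have distinct colours. -/
theorem col_ne_of_thread {x : ℕ → V} {i j k k' : ℕ} (hl : RainbowLinked G col (x i) (x j))
    (hinj : ∀ m m', i ≤ m → m ≤ j → i ≤ m' → m' ≤ j → x m = x m' → m = m')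
    {y : V} (hi : ∀ t, G.Adj (x i) t → t = y ∨ t = x (i + 1))
    (hx : ∀ m, i < m → m < j → ∀ t, G.Adj (x m) t → t = x (m - 1) ∨ t = x (m + 1))
    (hk : i ≤ k) (hkk : k < k') (hk' : k' < j) :
    col s(x k, x (k + 1)) ≠ col s(x k', x (k' + 1)) := by
  intro hc
  have hij : x i ≠ x j := fun h ↦ by
    have := hinj i j le_rfl (by lia) (by lia) le_rfl h
    lia
  have main : ∀ A B, IsTracePair G col (x i) (x j) A B → s(x i, x (i + 1)) ∈ A → False := by
    intro A B h hA
    have hall : ∀ m, i ≤ m → m < j → s(x m, x (m + 1)) ∈ A := fun m hm hmj ↦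
      h.left.mem_of_thread (j := j) (fun m hm hmj ↦ ⟨fun hh ↦ by
        have := hinj m i (by lia) (by lia) (by lia) (by lia) hh
        lia, fun hh ↦ by
        have := hinj m j (by lia) (by lia) (by lia) (by lia) hh
        lia, hx m hm hmj⟩) le_rfl (by lia) hm hmj hA
    have := h.left.rainbow (hall k hk (by lia)) (hall k' (by lia) hk') hc
    rcases Sym2.eq_iff.1 this with ⟨h1, _⟩ | ⟨h1, _⟩
    · have := hinj k k' (by lia) (by lia) (by lia) (by lia) h1
      lia
    · have := hinj k (k' + 1) (by lia) (by lia) (by lia) (by lia) h1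
      lia
  obtain ⟨A, B, h⟩ := hl.exists_isTracePair hij
  rcases (h.mem_or_mem hi).2 with h1 | h1
  · exact main A B h h1
  · exact main B A h.swap h1

end Traces

/-- `G` consists of three internally disjoint paths `P t` of lengths `l t` from `a` to `b`. -/
structure IsTheta {V : Type*} (G : SimpleGraph V) (l : Fin 3 → ℕ) (P : Fin 3 → ℕ → V)
    (a b : V) : Prop where
  pos : ∀ t, 1 ≤ l t
  start : ∀ t, P t 0 = a
  finish : ∀ t, P t (l t) = b
  ne : a ≠ b
  inj : ∀ {s t k k'}, 0 < k → k < l s → k' ≤ l t → P s k = P t k' → s = t ∧ k = k'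
  nbr : ∀ {t k y}, 0 < k → k < l t → (G.Adj (P t k) y ↔ y = P t (k - 1) ∨ y = P t (k + 1))
  nbr_start : ∀ {y}, G.Adj a y ↔ ∃ t, y = P t 1
  nbr_finish : ∀ {y}, G.Adj b y ↔ ∃ t, y = P t (l t - 1)
  one : ∀ {s t}, l s = 1 → l t = 1 → s = t
  surj : ∀ v, ∃ t k, k ≤ l t ∧ v = P t k

section Theta

variable {V α : Type*} {G : SimpleGraph V} {l : Fin 3 → ℕ} {P : Fin 3 → ℕ → V} {a b : V}
  {col : Sym2 V → α}

theorem IsTheta.reverse (h : IsTheta G l P a b) :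
    IsTheta G l (fun t k ↦ P t (l t - k)) b a where
  pos := h.pos
  start t := by simpa using h.finish t
  finish t := by simpa using h.start t
  ne := h.ne.symm
  inj {s t k k'} h0 h1 h2 h3 := by
    obtain ⟨rfl, h4⟩ := h.inj (by lia) (by lia) (by lia) h3
    exact ⟨rfl, by lia⟩
  nbr {t k y} h0 h1 := by
    rw [h.nbr (by lia) (by lia), or_comm]
    rw [show l t - k + 1 = l t - (k - 1) by lia, show l t - k - 1 = l t - (k + 1) by lia]
  nbr_start := h.nbr_finish
  nbr_finish {y} := by
    rw [h.nbr_start]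
    refine exists_congr fun t ↦ ?_
    have := h.pos t
    rw [show l t - (l t - 1) = 1 by lia]
  one := h.one
  surj v := by
    obtain ⟨t, k, hk, rfl⟩ := h.surj v
    exact ⟨t, l t - k, by lia, by rw [show l t - (l t - k) = k by lia]⟩

theorem IsTheta.ne_start (h : IsTheta G l P a b) {t : Fin 3} {k : ℕ} (hk : 0 < k)
    (hk' : k ≤ l t) : P t k ≠ a := by
  intro he
  rcases hk'.lt_or_eq with hlt | rfl
  · have := h.inj hk hlt (Nat.zero_le (l t)) (he.trans (h.start t).symm)
    lia
  · exact h.ne (he.symm.trans (h.finish t))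

theorem IsTheta.ne_finish (h : IsTheta G l P a b) {t : Fin 3} {k : ℕ} (hk : k < l t) :
    P t k ≠ b := by
  have := h.reverse.ne_start (t := t) (k := l t - k) (by lia) (by lia)
  rwa [show l t - (l t - k) = k by lia] at this

theorem IsTheta.injOn (h : IsTheta G l P a b) {t : Fin 3} {k k' : ℕ} (hk : k ≤ l t)
    (hk' : k' ≤ l t) (he : P t k = P t k') : k = k' := by
  rcases Nat.eq_zero_or_pos k with rfl | h0
  · rcases Nat.eq_zero_or_pos k' with rfl | h0'
    · rfl
    · exact absurd (he.symm.trans (h.start t)) (h.ne_start h0' hk')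
  · rcases hk.lt_or_eq with hlt | rfl
    · exact (h.inj h0 hlt hk' he).2
    · rcases hk'.lt_or_eq with hlt' | rfl
      · exact absurd (he.symm.trans (h.finish t)) (h.ne_finish hlt')
      · rfl

theorem IsTheta.edge_inj (h : IsTheta G l P a b) {s t : Fin 3} {k k' : ℕ} (hk : k < l s)
    (hk' : k' < l t) (he : s(P s k, P s (k + 1)) = s(P t k', P t (k' + 1))) :
    s = t ∧ k = k' := by
  have hst : s = t := by
    by_cases h1 : l s = 1
    · by_cases h2 : l t = 1
      · exact h.one h1 h2
      · rcases Nat.eq_zero_or_pos k' with rfl | h0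
        · rcases Sym2.eq_iff.1 he with ⟨_, h3⟩ | ⟨h3, _⟩
          · exact (h.inj (by lia) (by lia) (by lia) h3.symm).1.symm
          · exact (h.inj (by lia) (by lia) (by lia) h3.symm).1.symm
        · rcases Sym2.eq_iff.1 he with ⟨h3, _⟩ | ⟨_, h3⟩
          · exact (h.inj (by lia) (by lia) (by lia) h3.symm).1.symm
          · exact (h.inj (by lia) (by lia) (by lia) h3.symm).1.symm
    · rcases Nat.eq_zero_or_pos k with rfl | h0
      · rcases Sym2.eq_iff.1 he with ⟨_, h3⟩ | ⟨_, h3⟩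
        · exact (h.inj (by lia) (by lia) (by lia) h3).1
        · exact (h.inj (by lia) (by lia) (by lia) h3).1
      · rcases Sym2.eq_iff.1 he with ⟨h3, _⟩ | ⟨h3, _⟩
        · exact (h.inj (by lia) (by lia) (by lia) h3).1
        · exact (h.inj (by lia) (by lia) (by lia) h3).1
  subst hst
  refine ⟨rfl, ?_⟩
  rcases Sym2.eq_iff.1 he with ⟨h3, _⟩ | ⟨h3, h4⟩
  · exact h.injOn (by lia) (by lia) h3
  · have := h.injOn (by lia) (by lia) h3
    have := h.injOn (by lia) (by lia) h4
    lia

theorem IsTheta.same_aux (h : IsTheta G l P a b) (hc : RainbowTwoConnectedColouring G col)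
    {t : Fin 3} {k k' : ℕ} (h0 : 0 < k) (hk : k < k') (hk' : k' < l t) :
    col s(P t k, P t (k + 1)) ≠ col s(P t k', P t (k' + 1)) := by
  refine col_ne_of_thread (x := P t) (i := k) (j := k' + 1) (y := P t (k - 1)) (hc _ _ fun he ↦ ?_)
    (fun m m' _ _ _ _ he ↦ h.injOn (by lia) (by lia) he)
    (fun y ↦ (h.nbr h0 (by lia)).1) (fun m hm hm' y ↦ (h.nbr (by lia) (by lia)).1) le_rfl hk
    (by lia)
  have := h.injOn (by lia) (by lia) he
  lia

theorem IsTheta.reverse_edge {t : Fin 3} {k : ℕ} (hk : k < l t) :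
    s(P t (l t - (l t - 1 - k)), P t (l t - (l t - 1 - k + 1))) = s(P t k, P t (k + 1)) := by
  rw [show l t - (l t - 1 - k) = k + 1 by lia, show l t - (l t - 1 - k + 1) = k by lia,
    Sym2.eq_swap]

theorem IsTheta.same (h : IsTheta G l P a b) (hc : RainbowTwoConnectedColouring G col)
    {t : Fin 3} {k k' : ℕ} (hk : k < k') (hk' : k' < l t)
    (he : col s(P t k, P t (k + 1)) = col s(P t k', P t (k' + 1))) : k = 0 ∧ k' + 1 = l t := by
  by_contra hcon
  by_cases h0 : k = 0
  · refine h.reverse.same_aux hc (t := t) (k := l t - 1 - k') (k' := l t - 1 - k) (by lia) (by lia)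
      (by lia) ?_
    rw [IsTheta.reverse_edge (by lia), IsTheta.reverse_edge (by lia), he]
  · exact h.same_aux hc (by lia) hk hk' he

theorem IsTheta.cross_aux (h : IsTheta G l P a b) (hc : RainbowTwoConnectedColouring G col)
    {s t : Fin 3} {k k' : ℕ} (hst : s ≠ t) (hk : k + 1 < l s) (hk' : k' + 1 < l t) :
    col s(P s k, P s (k + 1)) ≠ col s(P t k', P t (k' + 1)) := by
  intro he
  have huv : P s (k + 1) ≠ P t (k' + 1) := fun hh ↦
    hst (h.inj (by lia) hk (by lia) hh).1
  have main : ∀ A B, IsTracePair G col (P s (k + 1)) (P t (k' + 1)) A B →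
      s(P s k, P s (k + 1)) ∈ A → False := by
    intro A B hAB hA
    have hs : s(P s 0, P s 1) ∈ A :=
      hAB.left.mem_of_thread (i := 0) (j := k + 1) (fun m hm hmj ↦ ⟨fun hh ↦ by
        have := h.injOn (by lia) (by lia) hh
        lia, fun hh ↦ hst (h.inj (by lia) (by lia) (by lia) hh).1,
        fun y ↦ (h.nbr hm (by lia)).1⟩) (Nat.zero_le k) (by lia) le_rfl (by lia) hA
    have ht : ∀ C, IsTrace G col (P s (k + 1)) (P t (k' + 1)) C → s(P t k', P t (k' + 1)) ∈ C →
        s(P t 0, P t 1) ∈ C := fun C hC hmem ↦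
      hC.mem_of_thread (i := 0) (j := k' + 1) (fun m hm hmj ↦ ⟨fun hh ↦
        hst.symm (h.inj (by lia) (by lia) (by lia) hh).1, fun hh ↦ by
        have := h.injOn (by lia) (by lia) hh
        lia, fun y ↦ (h.nbr hm (by lia)).1⟩) (Nat.zero_le k') (by lia) le_rfl (by lia) hmem
    have hend := (hAB.symm.mem_or_mem (y := P t k') (z := P t (k' + 2)) fun y ↦
      (h.nbr (by lia) hk').1).1
    rw [Sym2.eq_swap] at hend
    rcases hend with h1 | h1
    · exact hst (h.edge_inj (by lia) (by lia) (hAB.left.rainbow hA h1 he)).1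
    · have := ht B hAB.right h1
      rw [h.start] at this hs
      exact hAB.internal a (h.ne_start (by lia) (by lia)).symm
        (h.ne_start (by lia) (by lia)).symm _ _ hs this
  obtain ⟨A, B, hAB⟩ := RainbowLinked.exists_isTracePair (hc _ _ huv) huv
  have hend := (hAB.mem_or_mem (y := P s k) (z := P s (k + 2)) fun y ↦
    (h.nbr (by lia) hk).1).1
  rw [Sym2.eq_swap] at hend
  rcases hend with h1 | h1
  · exact main A B hAB h1
  · exact main B A hAB.swap h1

theorem IsTheta.cross (h : IsTheta G l P a b) (hc : RainbowTwoConnectedColouring G col)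
    {s t : Fin 3} {k k' : ℕ} (hst : s ≠ t) (hk : k < l s) (hk' : k' < l t)
    (he : col s(P s k, P s (k + 1)) = col s(P t k', P t (k' + 1))) :
    (k + 1 = l s ∨ k' + 1 = l t) ∧ (k = 0 ∨ k' = 0) := by
  constructor
  · by_contra hcon
    exact h.cross_aux hc hst (by lia) (by lia) he
  · by_contra hcon
    refine h.reverse.cross_aux hc hst (k := l s - 1 - k) (k' := l t - 1 - k') (by lia) (by lia) ?_
    rw [IsTheta.reverse_edge (by lia), IsTheta.reverse_edge (by lia), he]

theorem IsTheta.outer_aux (h : IsTheta G l P a b) (hc : RainbowTwoConnectedColouring G col)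
    {t : Fin 3} {k k' : ℕ} (hk : k < k') (hk' : k' ≤ l t) (h0 : 0 < k) :
    ∃ s, s ≠ t ∧
      (∀ m m', m < l s → m' < l t → (m' < k ∨ k' ≤ m') →
        col s(P s m, P s (m + 1)) ≠ col s(P t m', P t (m' + 1))) ∧
      (∀ m m', m < m' → m' < l s →
        col s(P s m, P s (m + 1)) ≠ col s(P s m', P s (m' + 1))) ∧
      ∀ m m', m < m' → m' < l t → (m < k ∨ k' ≤ m) → (m' < k ∨ k' ≤ m') →
        col s(P t m, P t (m + 1)) ≠ col s(P t m', P t (m' + 1)) := by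
  have huv : P t k ≠ P t k' := fun hh ↦ by
    have := h.injOn (by lia) (by lia) hh
    lia
  have main : ∀ A B, IsTracePair G col (P t k) (P t k') A B → s(P t k, P t (k - 1)) ∈ A →
      ∃ s, s ≠ t ∧ (∀ m, m < l s → s(P s m, P s (m + 1)) ∈ A) ∧
        ∀ m, m < l t → (m < k ∨ k' ≤ m) → s(P t m, P t (m + 1)) ∈ A := by
    intro A B hAB hA
    have hlow : ∀ m, m < k → s(P t m, P t (m + 1)) ∈ A := fun m hm ↦
      hAB.left.mem_of_thread (i := 0) (j := k) (m := k - 1) (fun m hm hmj ↦ ⟨fun hh ↦ by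
        have := h.injOn (by lia) (by lia) hh
        lia, fun hh ↦ by
        have := h.injOn (by lia) (by lia) hh
        lia, fun y ↦ (h.nbr hm (by lia)).1⟩) (Nat.zero_le _) (by lia) (Nat.zero_le m) hm
        (by rwa [Nat.sub_add_cancel h0, Sym2.eq_swap])
    have ha := hlow 0 h0
    rw [h.start, Nat.zero_add] at ha
    obtain ⟨s, hs⟩ : ∃ s, s ≠ t ∧ s(P s 0, P s (0 + 1)) ∈ A := by
      rcases hAB.left.internal a (h.ne_start h0 (by lia)).symm
        (h.ne_start (by lia) (by lia)).symm with h1 | ⟨y, z, hyz, h1⟩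
      · exact absurd ha (h1 _)
      · obtain ⟨w, hw, hwA⟩ : ∃ w, w ≠ P t 1 ∧ s(a, w) ∈ A := by
          by_cases hy : y = P t 1
          · exact ⟨z, fun hz ↦ hyz (hy.trans hz.symm), (h1 z).2 (Or.inr rfl)⟩
          · exact ⟨y, hy, (h1 y).2 (Or.inl rfl)⟩
        obtain ⟨s, rfl⟩ := h.nbr_start.1 (hAB.left.adj hwA)
        refine ⟨s, fun hh ↦ hw (by rw [hh]), ?_⟩
        rwa [h.start, Nat.zero_add]
    obtain ⟨hst, hs⟩ := hs
    have hall : ∀ m, m < l s → s(P s m, P s (m + 1)) ∈ A := fun m hm ↦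
      hAB.left.mem_of_thread (i := 0) (j := l s) (fun m hm hmj ↦ ⟨fun hh ↦
        hst (h.inj hm hmj (by lia) hh).1, fun hh ↦ hst (h.inj hm hmj (by lia) hh).1,
        fun y ↦ (h.nbr hm (by lia)).1⟩) le_rfl (by lia) (Nat.zero_le m) hm hs
    refine ⟨s, hst, hall, fun m hm hmk ↦ ?_⟩
    rcases hmk with hmk | hmk
    · exact hlow m hmk
    have hk'lt : k' < l t := by lia
    have hhigh : ∀ C, IsTrace G col (P t k) (P t k') C → s(P t k', P t (k' + 1)) ∈ C →
        ∀ m, k' ≤ m → m < l t → s(P t m, P t (m + 1)) ∈ C := fun C hC hmem m hm hml ↦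
      hC.mem_of_thread (i := k') (j := l t) (fun m hm hmj ↦ ⟨fun hh ↦ by
        have := h.injOn (by lia) (by lia) hh
        lia, fun hh ↦ by
        have := h.injOn (by lia) (by lia) hh
        lia, fun y ↦ (h.nbr (by lia) (by lia)).1⟩) le_rfl (by lia) hm hml hmem
    rcases (hAB.symm.mem_or_mem (y := P t (k' - 1)) (z := P t (k' + 1)) fun y ↦
      (h.nbr (by lia) hk'lt).1).2 with h1 | h1
    · exact hhigh A hAB.left h1 m hmk hm
    · exfalso
      have h2 := hhigh B hAB.right h1 (l t - 1) (by lia) (by lia)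
      have h3 := hall (l s - 1) (by have := h.pos s; lia)
      rw [Nat.sub_add_cancel (h.pos _), h.finish, Sym2.eq_swap] at h2 h3
      exact hAB.internal b (h.ne_finish (by lia)).symm (h.ne_finish hk'lt).symm _ _ h3 h2
  obtain ⟨A, B, hAB, hA⟩ : ∃ A B, IsTracePair G col (P t k) (P t k') A B ∧
      s(P t k, P t (k - 1)) ∈ A := by
    obtain ⟨A, B, hAB⟩ := RainbowLinked.exists_isTracePair (hc _ _ huv) huv
    rcases (hAB.mem_or_mem (y := P t (k - 1)) (z := P t (k + 1)) fun y ↦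
      (h.nbr h0 (by lia)).1).1 with h1 | h1
    · exact ⟨A, B, hAB, h1⟩
    · exact ⟨B, A, hAB.swap, h1⟩
  obtain ⟨s, hst, h1, h2⟩ := main A B hAB hA
  refine ⟨s, hst, fun m m' hm hm' hmk he ↦ ?_, fun m m' hm hm' he ↦ ?_,
    fun m m' hm hm' hmk hmk' he ↦ ?_⟩
  · exact hst (h.edge_inj hm hm' (hAB.left.rainbow (h1 m hm) (h2 m' hm' hmk) he)).1
  · have := (h.edge_inj (by lia) hm' (hAB.left.rainbow (h1 m (by lia)) (h1 m' hm') he)).2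
    lia
  · have := (h.edge_inj (by lia) hm'
      (hAB.left.rainbow (h2 m (by lia) hmk) (h2 m' hm' hmk') he)).2
    lia

theorem IsTheta.outer (h : IsTheta G l P a b) (hc : RainbowTwoConnectedColouring G col)
    {t : Fin 3} {k k' : ℕ} (hk : k < k') (hk' : k' ≤ l t) (h0 : 0 < k ∨ k' < l t) :
    ∃ s, s ≠ t ∧
      (∀ m m', m < l s → m' < l t → (m' < k ∨ k' ≤ m') →
        col s(P s m, P s (m + 1)) ≠ col s(P t m', P t (m' + 1))) ∧
      (∀ m m', m < m' → m' < l s →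
        col s(P s m, P s (m + 1)) ≠ col s(P s m', P s (m' + 1))) ∧
      ∀ m m', m < m' → m' < l t → (m < k ∨ k' ≤ m) → (m' < k ∨ k' ≤ m') →
        col s(P t m, P t (m + 1)) ≠ col s(P t m', P t (m' + 1)) := by
  by_cases hk0 : 0 < k
  · exact h.outer_aux hc hk hk' hk0
  · obtain ⟨s, hst, h1, h2, h3⟩ := h.reverse.outer_aux hc (t := t) (k := l t - k') (k' := l t - k)
      (by lia) (by lia) (by lia)
    refine ⟨s, hst, fun m m' hm hm' hmk ↦ ?_, fun m m' hm hm' ↦ ?_, fun m m' hm hm' hmk hmk' ↦ ?_⟩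
    · have := h1 (l s - 1 - m) (l t - 1 - m') (by lia) (by lia) (by lia)
      rwa [IsTheta.reverse_edge hm, IsTheta.reverse_edge hm'] at this
    · have := h2 (l s - 1 - m') (l s - 1 - m) (by lia) (by lia)
      rw [IsTheta.reverse_edge hm', IsTheta.reverse_edge (hm.trans hm')] at this
      exact this.symm
    · have := h3 (l t - 1 - m') (l t - 1 - m) (by lia) (by lia) (by lia) (by lia)
      rw [IsTheta.reverse_edge hm', IsTheta.reverse_edge (hm.trans hm')] at this
      exact this.symm

/-- A rainbow 2-connected colouring of a theta graph with a thread of length at least three uses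
at most two fewer colours than there are edges. -/
theorem IsTheta.sum_le (h : IsTheta G l P a b) (hlong : ∃ t, 3 ≤ l t) {r : ℕ}
    {col : Sym2 V → Fin r} (hc : RainbowTwoConnectedColouring G col) :
    l 0 + l 1 + l 2 ≤ r + 2 :=
  sum_le_of_thread_colouring (c := fun t k ↦ col s(P t k, P t (k + 1))) (fun _ _ ↦ h.one) h.pos
    hlong (fun _ _ _ ↦ h.same hc) (fun _ _ _ _ ↦ h.cross hc) fun _ _ _ ↦ h.outer hc

end Theta

section Injective

variable {V α : Type*} {G : SimpleGraph V} {l : Fin 3 → ℕ} {P : Fin 3 → ℕ → V} {a b : V}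
  {col : Sym2 V → α}

theorem IsCycleFn.rainbowLinked_of_injective {m : ℕ} {x : ℕ → V} (h : IsCycleFn G m x)
    (hcol : Function.Injective col) {s t : ℕ} (hs : s ≤ m) (ht : t ≤ m) (hne : s ≠ t) :
    RainbowLinked G col (x s) (x t) :=
  h.rainbowLinked_of_injOn (fun k k' hk hk' he ↦ by
    have := h.edge_inj (by lia) hk' (hcol he)
    lia) hs ht hne

theorem IsTheta.adj (h : IsTheta G l P a b) {t : Fin 3} {k : ℕ} (hk : k < l t) :
    G.Adj (P t k) (P t (k + 1)) := by
  rcases Nat.eq_zero_or_pos k with rfl | h0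
  · rw [h.start, h.nbr_start]
    exact ⟨t, rfl⟩
  · exact (h.nbr h0 hk).2 (Or.inr rfl)

theorem IsTheta.isCycleFn (h : IsTheta G l P a b) {s t : Fin 3} (hst : s ≠ t) :
    IsCycleFn G (l s + l t - 1) fun k ↦ if k ≤ l s then P s k else P t (l s + l t - k) where
  two_le := by
    have := h.pos s
    have := h.pos t
    by_contra hlt
    exact hst (h.one (by lia) (by lia))
  inj {i j} hi hj he := by
    have := h.pos s
    have := h.pos t
    split_ifs at he with h1 h2 h2
    · exact h.injOn h1 h2 he
    · exact absurd (h.inj (by lia) (by lia) h1 he.symm).1.symm hst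
    · exact absurd (h.inj (by lia) (by lia) h2 he).1.symm hst
    · have := h.injOn (by lia) (by lia) he
      lia
  adj {i} hi := by
    have := h.pos s
    have := h.pos t
    by_cases h1 : i + 1 ≤ l s
    · rw [if_pos (by lia), if_pos h1]
      exact h.adj h1
    · rw [if_neg h1]
      have hadj := (h.adj (t := t) (k := l s + l t - (i + 1)) (by lia)).symm
      rw [show l s + l t - (i + 1) + 1 = l s + l t - i by lia] at hadj
      by_cases h2 : i ≤ l s
      · obtain rfl : i = l s := by lia
        rwa [if_pos le_rfl, h.finish, ← h.finish t, show l t = l s + l t - l s by lia,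
          show l s + (l s + l t - l s) - (l s + 1) = l s + l t - (l s + 1) by lia]
      · rwa [if_neg h2]
  closed := by
    have := h.pos s
    have := h.pos t
    rw [if_neg (by lia), if_pos (by lia), show l s + l t - (l s + l t - 1 + 1) = 0 by lia, h.start,
      h.start]

theorem IsTheta.rainbowTwoConnectedColouring (h : IsTheta G l P a b)
    (hcol : Function.Injective col) : RainbowTwoConnectedColouring G col := by
  have main : ∀ s t k k', s ≠ t → k ≤ l s → k' ≤ l t → P s k ≠ P t k' →
      RainbowLinked G col (P s k) (P t k') := by
    intro s t k k' hst hk hk' hne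
    have hC := h.isCycleFn hst
    have := h.pos s
    have := h.pos t
    obtain ⟨i, hi, hik⟩ : ∃ i ≤ l s + l t - 1,
        (if i ≤ l s then P s i else P t (l s + l t - i)) = P t k' := by
      rcases Nat.eq_zero_or_pos k' with rfl | h0
      · exact ⟨0, by lia, by rw [if_pos (by lia), h.start, h.start]⟩
      · rcases hk'.lt_or_eq with hlt | rfl
        · exact ⟨l s + l t - k', by lia, by
            rw [if_neg (by lia), show l s + l t - (l s + l t - k') = k' by lia]⟩
        · exact ⟨l s, by lia, by rw [if_pos le_rfl, h.finish, h.finish]⟩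
    have hkk : (if k ≤ l s then P s k else P t (l s + l t - k)) = P s k := if_pos hk
    have := hC.rainbowLinked_of_injective hcol (s := k) (t := i) (by lia) hi
      (by rintro rfl; exact hne (hkk.symm.trans hik))
    simpa only [hik, hkk] using this
  intro u v huv
  obtain ⟨s, k, hk, rfl⟩ := h.surj u
  obtain ⟨t, k', hk', rfl⟩ := h.surj v
  by_cases hst : s = t
  · subst hst
    obtain ⟨t, hst⟩ : ∃ t, s ≠ t := (exists_ne s).imp fun _ ↦ Ne.symm
    have hC := h.isCycleFn hst
    have := h.pos t
    have h1 : (if k ≤ l s then P s k else P t (l s + l t - k)) = P s k := if_pos hk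
    have h2 : (if k' ≤ l s then P s k' else P t (l s + l t - k')) = P s k' := if_pos hk'
    have := hC.rainbowLinked_of_injective hcol (s := k) (t := k') (by lia) (by lia)
      (by rintro rfl; exact huv rfl)
    simp only [h1, h2] at this
    exact this
  · exact main s t k k' hst hk hk' huv

/-- `G` is a cycle with vertices `x 0`, …, `x m`. -/
structure IsCycleGraph (G : SimpleGraph V) (m : ℕ) (x : ℕ → V) : Prop extends
    IsCycleFn G m x where
  nbr : ∀ {k y}, 0 < k → k ≤ m → G.Adj (x k) y → y = x (k - 1) ∨ y = x (k + 1)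
  nbr_start : ∀ {y}, G.Adj (x 0) y → y = x m ∨ y = x 1
  surj : ∀ v, ∃ k ≤ m, v = x k

theorem IsCycleGraph.rainbowTwoConnectedColouring {m : ℕ} {x : ℕ → V} (h : IsCycleGraph G m x)
    (hcol : Function.Injective col) : RainbowTwoConnectedColouring G col := by
  intro u v huv
  obtain ⟨s, hs, rfl⟩ := h.surj u
  obtain ⟨t, ht, rfl⟩ := h.surj v
  exact h.rainbowLinked_of_injective hcol hs ht (by rintro rfl; exact huv rfl)

/-- A rainbow 2-connected colouring of a cycle uses at most one fewer colour than there are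
edges. -/
theorem IsCycleGraph.le {m : ℕ} {x : ℕ → V} (h : IsCycleGraph G m x) {r : ℕ}
    {col : Sym2 V → Fin r} (hc : RainbowTwoConnectedColouring G col) : m ≤ r := by
  have h2 := h.two_le
  have key : ∀ k k', k < k' → k' < m → col s(x k, x (k + 1)) ≠ col s(x k', x (k' + 1)) :=
    fun k k' hk hk' ↦ col_ne_of_thread (x := x) (i := 0) (j := m) (y := x m)
      (hc _ _ fun he ↦ by
        have := h.inj (by lia) le_rfl he
        lia) (fun s t _ hs _ ht ↦ h.inj hs ht) (fun t ↦ h.nbr_start)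
      (fun s hs hs' t ↦ h.nbr hs (by lia)) (Nat.zero_le k) hk hk'
  have h1 : (Finset.range m).card ≤ (Finset.univ : Finset (Fin r)).card := by
    refine Finset.card_le_card_of_injOn (fun k ↦ col s(x k, x (k + 1)))
      (fun _ _ ↦ Finset.mem_univ _) ?_
    intro k hk k' hk' he
    simp only [Finset.coe_range, Set.mem_Iio] at hk hk'
    rcases Nat.lt_trichotomy k k' with hlt | rfl | hlt
    · exact absurd he (key _ _ hlt hk')
    · rfl
    · exact absurd he.symm (key _ _ hlt hk)
  simpa using h1

end Injective

section Degrees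

variable {V : Type*} [Fintype V] {G : SimpleGraph V}

theorem TwoConnected.exists_adj_boundary (h : TwoConnected G) {w : V} {S : Set V}
    {a b : V} (ha : a ∈ S) (haw : a ≠ w) (hb : b ∉ S) (hbw : b ≠ w) :
    ∃ p q, p ∈ S ∧ q ∉ S ∧ p ≠ w ∧ q ≠ w ∧ G.Adj p q := by
  obtain ⟨p⟩ := (h.2 w).preconnected ⟨a, haw⟩ ⟨b, hbw⟩
  obtain ⟨d, -, h1, h2⟩ := p.exists_boundary_dart (Subtype.val ⁻¹' S) ha hb
  exact ⟨d.fst, d.snd, h1, h2, d.fst.2, d.snd.2, d.adj⟩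

theorem TwoConnected.exists_ne (h : TwoConnected G) (a b : V) : ∃ c, c ≠ a ∧ c ≠ b := by
  classical
  by_contra! hcon
  have hsub : (Finset.univ : Finset V) ⊆ {a, b} := fun c _ ↦ by
    have := hcon c
    simp only [Finset.mem_insert, Finset.mem_singleton]
    tauto
  have h1 := Finset.card_le_card hsub
  have h2 : ({a, b} : Finset V).card ≤ 2 := Finset.card_le_two
  have := h.1
  rw [Finset.card_univ] at h1
  lia

theorem TwoConnected.eq_univ_of_closed (h : TwoConnected G) {S : Set V} {a : V} (ha : a ∈ S)
    (hS : ∀ p q, p ∈ S → G.Adj p q → q ∈ S) (b : V) : b ∈ S := by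
  by_contra hb
  obtain ⟨c, hca, hcb⟩ := h.exists_ne a b
  obtain ⟨p, q, hp, hq, -, -, hpq⟩ := h.exists_adj_boundary ha hca.symm hb hcb.symm
  exact hq (hS p q hp hpq)

theorem TwoConnected.exists_adj_ne (h : TwoConnected G) (v y : V) : ∃ z, z ≠ y ∧ G.Adj v z := by
  obtain ⟨y', hy', hyy'⟩ : ∃ y', y' ≠ v ∧ (y ≠ v → y' = y) := by
    by_cases hy : y = v
    · obtain ⟨c, hc, -⟩ := h.exists_ne v v
      exact ⟨c, hc, fun h ↦ absurd hy h⟩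
    · exact ⟨y, hy, fun _ ↦ rfl⟩
  obtain ⟨c, hcv, hcy⟩ := h.exists_ne v y'
  obtain ⟨p, q, hp, -, -, hqy, hpq⟩ :=
    h.exists_adj_boundary (S := {v}) (Set.mem_singleton v) hy'.symm (b := c) hcv hcy
  obtain rfl : p = v := hp
  refine ⟨q, fun hq ↦ ?_, hpq⟩
  subst hq
  exact hqy (hyy' hpq.ne').symm

variable [DecidableRel G.Adj]

theorem card_le_degree {v : V} {T : Finset V} (hT : ∀ t ∈ T, G.Adj v t) :
    T.card ≤ G.degree v := by
  rw [← card_neighborFinset_eq_degree]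
  exact Finset.card_le_card fun t ht ↦ (mem_neighborFinset _ _ _).2 (hT t ht)

theorem mem_of_degree_le {v : V} {T : Finset V} (hT : ∀ t ∈ T, G.Adj v t)
    (hd : G.degree v ≤ T.card) {t : V} (ht : G.Adj v t) : t ∈ T := by
  have h1 : T ⊆ G.neighborFinset v := fun t ht ↦ (mem_neighborFinset _ _ _).2 (hT t ht)
  rw [Finset.eq_of_subset_of_card_le h1 (by rwa [card_neighborFinset_eq_degree])]
  exact (mem_neighborFinset _ _ _).2 ht

variable [DecidableEq V]

theorem TwoConnected.two_le_degree (h : TwoConnected G) (v : V) : 2 ≤ G.degree v := by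
  obtain ⟨y, -, hy⟩ := h.exists_adj_ne v v
  obtain ⟨z, hzy, hz⟩ := h.exists_adj_ne v y
  rw [← card_neighborFinset_eq_degree, ← Finset.card_pair hzy]
  exact Finset.card_le_card fun t ht ↦ by
    simp only [Finset.mem_insert, Finset.mem_singleton] at ht
    rw [mem_neighborFinset]
    rcases ht with rfl | rfl <;> assumption

theorem TwoConnected.sum_degree_le (h : TwoConnected G)
    (he : G.edgeSet.ncard ≤ Fintype.card V + 1) (T : Finset V) :
    ∑ v ∈ T, G.degree v ≤ 2 * T.card + 2 := by
  have h1 := G.sum_degrees_eq_twice_card_edges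
  have h2 : G.edgeSet.ncard = G.edgeFinset.card := by
    rw [← coe_edgeFinset, Set.ncard_coe_finset]
  have h3 := Finset.sum_add_sum_compl T fun v ↦ G.degree v
  have h4 : ∑ _v ∈ Tᶜ, 2 ≤ ∑ v ∈ Tᶜ, G.degree v :=
    Finset.sum_le_sum fun v _ ↦ h.two_le_degree v
  rw [Finset.sum_const, smul_eq_mul] at h4
  have h5 := Finset.card_add_card_compl T
  lia

theorem eq_or_eq_of_degree_le_two {v y z : V} (hy : G.Adj v y) (hz : G.Adj v z) (hyz : y ≠ z)
    (hd : G.degree v ≤ 2) {t : V} (ht : G.Adj v t) : t = y ∨ t = z := by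
  have := mem_of_degree_le (T := {y, z}) (by simp [hy, hz]) (by rwa [Finset.card_pair hyz]) ht
  simpa using this

theorem three_le_degree {v y z w : V} (hy : G.Adj v y) (hz : G.Adj v z) (hw : G.Adj v w)
    (hyz : y ≠ z) (hyw : y ≠ w) (hzw : z ≠ w) : 3 ≤ G.degree v := by
  have := card_le_degree (G := G) (v := v) (T := {y, z, w}) (by simp [hy, hz, hw])
  rwa [Finset.card_eq_three.2 ⟨y, z, w, hyz, hyw, hzw, rfl⟩] at this

theorem eq_or_eq_or_eq_of_degree_le_three {v y z w : V} (hy : G.Adj v y) (hz : G.Adj v z)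
    (hw : G.Adj v w) (hyz : y ≠ z) (hyw : y ≠ w) (hzw : z ≠ w) (hd : G.degree v ≤ 3) {t : V}
    (ht : G.Adj v t) : t = y ∨ t = z ∨ t = w := by
  have := mem_of_degree_le (T := {y, z, w}) (by simp [hy, hz, hw])
    (by rwa [Finset.card_eq_three.2 ⟨y, z, w, hyz, hyw, hzw, rfl⟩]) ht
  simpa using this

end Degrees

section Paths

variable {V : Type*} {G : SimpleGraph V} {m : ℕ} {x : ℕ → V}

theorem IsPathFn.reverse (h : IsPathFn G m x) : IsPathFn G m fun k ↦ x (m - k) where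
  inj hs ht he := by
    have := h.inj (by lia) (by lia) he
    lia
  adj {s} hs := by
    have := h.adj (s := m - (s + 1)) (by lia)
    rw [show m - (s + 1) + 1 = m - s by lia] at this
    exact this.symm

theorem IsPathFn.adj_pred (h : IsPathFn G m x) {k : ℕ} (h0 : 0 < k) (hk : k ≤ m) :
    G.Adj (x k) (x (k - 1)) := by
  have := h.adj (s := k - 1) (by lia)
  rw [Nat.sub_add_cancel h0] at this
  exact this.symm

theorem IsPathFn.cons (h : IsPathFn G m x) {y : V} (hy : ∀ k ≤ m, y ≠ x k)
    (hadj : G.Adj y (x 0)) : IsPathFn G (m + 1) fun k ↦ if k = 0 then y else x (k - 1) where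
  inj {s t} hs ht he := by
    split_ifs at he with h1 h2 h2
    · lia
    · exact absurd he (hy _ (by lia))
    · exact absurd he.symm (hy _ (by lia))
    · have := h.inj (by lia) (by lia) he
      lia
  adj {s} hs := by
    rcases Nat.eq_zero_or_pos s with rfl | h0
    · simpa using hadj
    · rw [if_neg (by lia), if_neg (by lia)]
      have := h.adj (s := s - 1) (by lia)
      rwa [show s - 1 + 1 = s + 1 - 1 by lia] at this

theorem exists_longest_path [Fintype V] [Nonempty V] (G : SimpleGraph V) :
    ∃ m x, IsPathFn G m x ∧ ∀ x', ¬ IsPathFn G (m + 1) x' := by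
  by_contra! hcon
  have hall : ∀ m, ∃ x, IsPathFn G m x := by
    intro m
    induction m with
    | zero =>
      obtain ⟨v⟩ := ‹Nonempty V›
      exact ⟨fun _ ↦ v, fun hs ht _ ↦ by lia, fun hs ↦ by lia⟩
    | succ m ih =>
      obtain ⟨x, hx⟩ := ih
      exact hcon m x hx
  obtain ⟨x, hx⟩ := hall (Fintype.card V)
  have := Fintype.card_le_of_injective (fun k : Fin (Fintype.card V + 1) ↦ x k) fun s t he ↦
    Fin.ext (hx.inj (by lia) (by lia) he)
  simp at this

theorem IsPathFn.exists_adj_start [Fintype V] (h : IsPathFn G m x) (hG : TwoConnected G)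
    (hmax : ∀ x', ¬ IsPathFn G (m + 1) x') : ∃ j, 2 ≤ j ∧ j ≤ m ∧ G.Adj (x 0) (x j) := by
  obtain ⟨z, hz, hadj⟩ := hG.exists_adj_ne (x 0) (x 1)
  by_contra! hcon
  refine hmax _ (h.cons (fun k hk he ↦ ?_) hadj.symm)
  subst he
  have h0 : k ≠ 0 := by
    rintro rfl
    exact hadj.ne rfl
  have h1 : k ≠ 1 := by
    rintro rfl
    exact hz rfl
  exact hcon k (by lia) hk hadj

/-- Rotating a cycle through all vertices of the path gives a longer path if the cycle does not
contain all vertices. -/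
theorem IsPathFn.surj_of_adj [Fintype V] (h : IsPathFn G m x) (hG : TwoConnected G)
    (hmax : ∀ x', ¬ IsPathFn G (m + 1) x') (hadj : G.Adj (x m) (x 0)) (v : V) :
    ∃ k ≤ m, v = x k := by
  refine hG.eq_univ_of_closed (S := {v | ∃ k ≤ m, v = x k}) (a := x 0) ⟨0, Nat.zero_le _, rfl⟩ ?_ v
  rintro _ q ⟨k, hk, rfl⟩ hpq
  by_contra hq
  have hrot : IsPathFn G m fun t ↦ if t + k ≤ m then x (t + k) else x (t + k - (m + 1)) := by
    refine ⟨fun {s t} hs ht he ↦ ?_, fun {s} hs ↦ ?_⟩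
    · split_ifs at he with h1 h2 h2 <;>
      · have := h.inj (by lia) (by lia) he
        lia
    · by_cases h1 : s + 1 + k ≤ m
      · rw [if_pos (by lia), if_pos h1, show s + 1 + k = s + k + 1 by lia]
        exact h.adj (by lia)
      · rw [if_neg h1]
        by_cases h2 : s + k ≤ m
        · rwa [if_pos h2, show s + k = m by lia, show s + 1 + k - (m + 1) = 0 by lia]
        · rw [if_neg h2, show s + 1 + k - (m + 1) = s + k - (m + 1) + 1 by lia]
          exact h.adj (by lia)
  refine hmax _ (hrot.cons (y := q) (fun t ht he ↦ hq ?_) ?_)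
  · split_ifs at he with h1
    · exact ⟨_, h1, he⟩
    · exact ⟨_, by lia, he⟩
  · rw [Nat.zero_add, if_pos hk]
    exact hpq.symm

theorem IsPathFn.card_eq [Fintype V] (h : IsPathFn G m x) (hs : ∀ v, ∃ k ≤ m, v = x k) :
    Fintype.card V = m + 1 := by
  have : Function.Bijective fun k : Fin (m + 1) ↦ x k := by
    refine ⟨fun s t he ↦ Fin.ext (h.inj (by lia) (by lia) he), fun v ↦ ?_⟩
    obtain ⟨k, hk, rfl⟩ := hs v
    exact ⟨⟨k, by lia⟩, rfl⟩
  rw [← Fintype.card_of_bijective this, Fintype.card_fin]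

end Paths

section Structure

variable {V : Type*} {G : SimpleGraph V} {m : ℕ} {x : ℕ → V}

/-- The path obtained from the cycle `x 0`, …, `x m` and its chord from `x k` to `x g`. -/
theorem IsPathFn.of_chord (h : IsPathFn G m x) (hm : G.Adj (x m) (x 0)) {k g : ℕ} (hkg : k < g)
    (hg : g ≤ m) (hadj : G.Adj (x k) (x g)) :
    IsPathFn G m fun t ↦ if t < g - k then x (k + 1 + t) else
      if t ≤ g then x (g - t) else x (m - (t - g - 1)) where
  inj {s t} hs ht he := by
    split_ifs at he <;>
    · have := h.inj (by lia) (by lia) he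
      lia
  adj {t} ht := by
    by_cases h1 : t + 1 < g - k
    · rw [if_pos (by lia), if_pos h1, show k + 1 + (t + 1) = k + 1 + t + 1 by lia]
      exact h.adj (by lia)
    rw [if_neg h1]
    by_cases h2 : t < g - k
    · rw [if_pos h2, if_pos (by lia), show k + 1 + t = g by lia, show g - (t + 1) = k by lia]
      exact hadj.symm
    rw [if_neg h2]
    by_cases h3 : t + 1 ≤ g
    · rw [if_pos (by lia), if_pos h3, show g - (t + 1) = g - t - 1 by lia]
      exact h.adj_pred (by lia) (by lia)
    rw [if_neg h3]
    by_cases h4 : t ≤ g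
    · rw [if_pos h4, show g - t = 0 by lia, show m - (t + 1 - g - 1) = m by lia]
      exact hm.symm
    · rw [if_neg h4, show m - (t + 1 - g - 1) = m - (t - g - 1) - 1 by lia]
      exact h.adj_pred (by lia) (by lia)

/-- The indices along the path `x 0`, …, `x m` of the threads from `x j` to `x i`, in a graph
formed by this path and the chords joining `x 0` to `x j` and `x m` to `x i`. -/
def thetaIndex (m i j : ℕ) : Fin 3 → ℕ → ℕ :=
  ![fun k ↦ j - k, fun k ↦ if k ≤ m - j then j + k else i, fun k ↦ if k = 0 then j else k - 1]

theorem isTheta_of_path {i j : ℕ} (h : IsPathFn G m x) (hij : i < j) (hi : 0 < i) (hj : j < m)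
    (hsurj : ∀ v, ∃ k ≤ m, v = x k)
    (hk : ∀ k y, 0 < k → k < m → k ≠ i → k ≠ j →
      (G.Adj (x k) y ↔ y = x (k - 1) ∨ y = x (k + 1)))
    (h0 : ∀ y, G.Adj (x 0) y ↔ y = x 1 ∨ y = x j)
    (hm : ∀ y, G.Adj (x m) y ↔ y = x (m - 1) ∨ y = x i)
    (hki : ∀ y, G.Adj (x i) y ↔ y = x (i - 1) ∨ y = x (i + 1) ∨ y = x m)
    (hkj : ∀ y, G.Adj (x j) y ↔ y = x (j - 1) ∨ y = x (j + 1) ∨ y = x 0) :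
    IsTheta G ![j - i, m - j + 1, i + 1] (fun t k ↦ x (thetaIndex m i j t k)) (x j) (x i) where
  pos t := by fin_cases t <;> simp; lia
  start t := by fin_cases t <;> simp [thetaIndex]
  finish t := by
    fin_cases t <;> simp [thetaIndex]
    congr 1
    lia
  ne he := by
    have := h.inj (by lia) (by lia) he
    lia
  inj {s t k k'} h1 h2 h3 he := by
    have he' : thetaIndex m i j s k = thetaIndex m i j t k' := by
      refine h.inj ?_ ?_ he
      · fin_cases s <;> simp [thetaIndex] at h2 ⊢ <;> (try split_ifs) <;> lia
      · fin_cases t <;> simp [thetaIndex] at h3 ⊢ <;> (try split_ifs) <;> lia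
    clear he
    fin_cases s <;> fin_cases t <;> simp [thetaIndex] at h2 h3 he' ⊢ <;>
      (try split_ifs at he') <;> lia
  nbr {t k y} h1 h2 := by
    fin_cases t
    · simp [thetaIndex] at h2 ⊢
      rw [hk _ _ (by lia) (by lia) (by lia) (by lia), or_comm,
        show j - k + 1 = j - (k - 1) by lia, show j - k - 1 = j - (k + 1) by lia]
    · simp [thetaIndex] at h2 ⊢
      rw [if_pos (show k ≤ m - j by lia), if_pos (show k ≤ m - j + 1 by lia)]
      by_cases hkm : k < m - j
      · rw [if_pos hkm, hk _ _ (by lia) (by lia) (by lia) (by lia),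
          show j + k - 1 = j + (k - 1) by lia, show j + k + 1 = j + (k + 1) by lia]
      · rw [if_neg hkm, show j + k = m by lia, hm, show m - 1 = j + (k - 1) by lia]
    · simp [thetaIndex] at h2 ⊢
      rw [if_neg (by lia)]
      by_cases hk1 : k = 1
      · subst hk1
        simp [h0, or_comm]
      · rw [if_neg (by lia), hk _ _ (by lia) (by lia) (by lia) (by lia),
          show k - 1 + 1 = k by lia]
  nbr_start {y} := by
    rw [hkj]
    simp [thetaIndex, Fin.exists_fin_succ, show 1 ≤ m - j by lia]
  nbr_finish {y} := by
    rw [hki]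
    simp [thetaIndex, Fin.exists_fin_succ, show i ≠ 0 by lia, show j - (j - i - 1) = i + 1 by lia,
      show j + (m - j) = m by lia]
    tauto
  one {s t} hs ht := by
    fin_cases s <;> fin_cases t <;> simp at hs ht ⊢ <;> lia
  surj v := by
    obtain ⟨k, hk, rfl⟩ := hsurj v
    by_cases h1 : k < i
    · exact ⟨2, k + 1, by simp; lia, by simp [thetaIndex]⟩
    · by_cases h2 : k ≤ j
      · exact ⟨0, j - k, by simp; lia, by simp [thetaIndex, show j - (j - k) = k by lia]⟩
      · refine ⟨1, k - j, by simp; lia, ?_⟩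
        simp [thetaIndex, show j + (k - j) = k by lia, show k ≤ m - j + j by lia]

variable [Fintype V]

theorem four_le_degree [DecidableEq V] [DecidableRel G.Adj] {v y z w u : V} (hy : G.Adj v y)
    (hz : G.Adj v z) (hw : G.Adj v w) (hu : G.Adj v u) (hyz : y ≠ z) (hyw : y ≠ w) (hyu : y ≠ u)
    (hzw : z ≠ w) (hzu : z ≠ u) (hwu : w ≠ u) : 4 ≤ G.degree v := by
  have := card_le_degree (G := G) (v := v) (T := {y, z, w, u}) (by simp [hy, hz, hw, hu])
  rwa [Finset.card_insert_of_notMem (by simp [hyz, hyw, hyu]),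
    Finset.card_eq_three.2 ⟨z, w, u, hzw, hzu, hwu, rfl⟩] at this

theorem exists_isTheta_of_path {i j : ℕ} (hG : TwoConnected G)
    (he : G.edgeSet.ncard ≤ Fintype.card V + 1) (h : IsPathFn G m x) (hj : 2 ≤ j) (hjm : j < m)
    (hi : 0 < i) (him : i + 2 ≤ m) (h0j : G.Adj (x 0) (x j)) (hmi : G.Adj (x m) (x i)) :
    ∃ l P a b, IsTheta G l P a b ∧ l 0 + l 1 + l 2 = Fintype.card V + 1 := by
  classical
  have hne : ∀ {s t}, s ≤ m → t ≤ m → s ≠ t → x s ≠ x t := fun hs ht hst hh ↦ hst (h.inj hs ht hh)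
  have hdi : 3 ≤ G.degree (x i) := three_le_degree (h.adj_pred hi (by lia)) (h.adj (by lia))
    hmi.symm (hne (by lia) (by lia) (by lia)) (hne (by lia) (by lia) (by lia))
    (hne (by lia) (by lia) (by lia))
  have hdj : 3 ≤ G.degree (x j) := three_le_degree (h.adj_pred (by lia) (by lia)) (h.adj (by lia))
    h0j.symm (hne (by lia) (by lia) (by lia)) (hne (by lia) (by lia) (by lia))
    (hne (by lia) (by lia) (by lia))
  have sum2 : ∀ {s t}, s ≤ m → t ≤ m → s ≠ t → G.degree (x s) + G.degree (x t) ≤ 6 := by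
    intro s t hs ht hst
    have := hG.sum_degree_le he {x s, x t}
    rwa [Finset.sum_pair (hne hs ht hst), Finset.card_pair (hne hs ht hst)] at this
  have sum3 : ∀ {s}, s ≤ m → s ≠ i → s ≠ j → i ≠ j → G.degree (x s) ≤ 2 := by
    intro s hs hsi hsj hij
    have h1 := hne hs (by lia) hsi
    have h2 := hne hs (by lia) hsj
    have h3 : x i ≠ x j := hne (by lia) (by lia) hij
    have := hG.sum_degree_le he {x s, x i, x j}
    rw [Finset.sum_insert (by simp [h1, h2]), Finset.sum_pair h3,
      Finset.card_eq_three.2 ⟨_, _, _, h1, h2, h3, rfl⟩] at this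
    lia
  have hinner : ∀ {k y}, 0 < k → k < m → G.degree (x k) ≤ 2 → G.Adj (x k) y →
      y = x (k - 1) ∨ y = x (k + 1) := fun h0 hkm hd ↦
    eq_or_eq_of_degree_le_two (h.adj_pred h0 hkm.le) (h.adj hkm)
      (hne (by lia) (by lia) (by lia)) hd
  have hfirst : ∀ {y}, G.degree (x 0) ≤ 2 → G.Adj (x 0) y → y = x 1 ∨ y = x j := fun hd ↦
    eq_or_eq_of_degree_le_two (h.adj (by lia)) h0j (hne (by lia) (by lia) (by lia)) hd
  have hij : i < j := by
    by_contra hij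
    have hd : ∀ {k}, k < j → G.degree (x k) ≤ 2 := by
      intro k hkj
      by_cases hij' : i = j
      · subst hij'
        have h4 : 4 ≤ G.degree (x i) := four_le_degree (h.adj_pred hi (by lia)) (h.adj (by lia))
          hmi.symm h0j.symm (hne (by lia) (by lia) (by lia)) (hne (by lia) (by lia) (by lia))
          (hne (by lia) (by lia) (by lia)) (hne (by lia) (by lia) (by lia))
          (hne (by lia) (by lia) (by lia)) (hne (by lia) (by lia) (by lia))
        have := sum2 (s := k) (t := i) (by lia) (by lia) (by lia)
        lia
      · exact sum3 (by lia) (by lia) (by lia) hij'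
    obtain ⟨p, q, ⟨k, hk, rfl⟩, hq, -, hqj, hpq⟩ :=
      hG.exists_adj_boundary (w := x j) (S := {v | ∃ k < j, v = x k}) (a := x 0) (b := x m)
        ⟨0, by lia, rfl⟩ (hne (by lia) (by lia) (by lia))
        (by
          rintro ⟨k, hk, hh⟩
          have := h.inj (by lia) (by lia) hh
          lia) (hne (by lia) (by lia) (by lia))
    rcases Nat.eq_zero_or_pos k with rfl | h0
    · rcases hfirst (hd hk) hpq with rfl | rfl
      · exact hq ⟨1, by lia, rfl⟩
      · exact hqj rfl
    · rcases hinner h0 (by lia) (hd hk) hpq with rfl | rfl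
      · exact hq ⟨k - 1, by lia, rfl⟩
      · by_cases hkj : k + 1 = j
        · exact hqj (by rw [hkj])
        · exact hq ⟨k + 1, by lia, rfl⟩
  have hij6 := sum2 (s := i) (t := j) (by lia) (by lia) (by lia)
  have hd : ∀ {k}, k ≤ m → k ≠ i → k ≠ j → G.degree (x k) ≤ 2 := fun h1 h2 h3 ↦
    sum3 h1 h2 h3 hij.ne
  have hk : ∀ k y, 0 < k → k < m → k ≠ i → k ≠ j →
      (G.Adj (x k) y ↔ y = x (k - 1) ∨ y = x (k + 1)) := fun k y h1 h2 h3 h4 ↦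
    ⟨hinner h1 h2 (hd h2.le h3 h4), by
      rintro (rfl | rfl)
      exacts [h.adj_pred h1 h2.le, h.adj h2]⟩
  have h0 : ∀ y, G.Adj (x 0) y ↔ y = x 1 ∨ y = x j := fun y ↦
    ⟨hfirst (hd (by lia) (by lia) (by lia)), by
      rintro (rfl | rfl)
      exacts [h.adj (by lia), h0j]⟩
  have hm : ∀ y, G.Adj (x m) y ↔ y = x (m - 1) ∨ y = x i := fun y ↦
    ⟨eq_or_eq_of_degree_le_two (h.adj_pred (by lia) le_rfl) hmi (hne (by lia) (by lia) (by lia))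
      (hd (by lia) (by lia) (by lia)), by
      rintro (rfl | rfl)
      exacts [h.adj_pred (by lia) le_rfl, hmi]⟩
  have hki : ∀ y, G.Adj (x i) y ↔ y = x (i - 1) ∨ y = x (i + 1) ∨ y = x m := fun y ↦
    ⟨eq_or_eq_or_eq_of_degree_le_three (h.adj_pred hi (by lia)) (h.adj (by lia))
      hmi.symm (hne (by lia) (by lia) (by lia)) (hne (by lia) (by lia) (by lia))
      (hne (by lia) (by lia) (by lia)) (by lia), by
      rintro (rfl | rfl | rfl)
      exacts [h.adj_pred hi (by lia), h.adj (by lia), hmi.symm]⟩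
  have hkj : ∀ y, G.Adj (x j) y ↔ y = x (j - 1) ∨ y = x (j + 1) ∨ y = x 0 := fun y ↦
    ⟨eq_or_eq_or_eq_of_degree_le_three (h.adj_pred (by lia) (by lia)) (h.adj (by lia))
      h0j.symm (hne (by lia) (by lia) (by lia)) (hne (by lia) (by lia) (by lia))
      (hne (by lia) (by lia) (by lia)) (by lia), by
      rintro (rfl | rfl | rfl)
      exacts [h.adj_pred (by lia) (by lia), h.adj (by lia), h0j.symm]⟩
  have hsurj : ∀ v, ∃ k ≤ m, v = x k := by
    refine hG.eq_univ_of_closed (S := {v | ∃ k ≤ m, v = x k}) (a := x 0) ⟨0, by lia, rfl⟩ ?_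
    rintro _ q ⟨k, hkm, rfl⟩ hpq
    by_cases h1 : k = i
    · subst h1
      rcases (hki q).1 hpq with rfl | rfl | rfl
      exacts [⟨_, by lia, rfl⟩, ⟨_, by lia, rfl⟩, ⟨_, by lia, rfl⟩]
    by_cases h2 : k = j
    · subst h2
      rcases (hkj q).1 hpq with rfl | rfl | rfl
      exacts [⟨_, by lia, rfl⟩, ⟨_, by lia, rfl⟩, ⟨_, by lia, rfl⟩]
    by_cases h3 : k = 0
    · subst h3
      rcases (h0 q).1 hpq with rfl | rfl
      exacts [⟨_, by lia, rfl⟩, ⟨_, by lia, rfl⟩]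
    by_cases h4 : k = m
    · subst h4
      rcases (hm q).1 hpq with rfl | rfl
      exacts [⟨_, by lia, rfl⟩, ⟨_, by lia, rfl⟩]
    rcases (hk k q (by lia) (by lia) h1 h2).1 hpq with rfl | rfl
    exacts [⟨_, by lia, rfl⟩, ⟨_, by lia, rfl⟩]
  refine ⟨_, _, _, _, isTheta_of_path h hij hi hjm hsurj hk h0 hm hki hkj, ?_⟩
  rw [h.card_eq hsurj]
  simp
  lia

theorem exists_isTheta_of_chord (hG : TwoConnected G)
    (he : G.edgeSet.ncard ≤ Fintype.card V + 1) (h : IsPathFn G m x) (hm : G.Adj (x m) (x 0))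
    {k g : ℕ} (hkg : k + 2 ≤ g) (hg : g ≤ m) (hne : k ≠ 0 ∨ g ≠ m) (hadj : G.Adj (x k) (x g)) :
    ∃ l P a b, IsTheta G l P a b ∧ l 0 + l 1 + l 2 = Fintype.card V + 1 := by
  refine exists_isTheta_of_path (i := g - k - 1) (j := g - k) hG he
    (h.of_chord hm (by lia) hg hadj) (by lia) (by lia) (by lia) (by lia) ?_ ?_
  · rw [if_pos (by lia), if_neg (by lia), if_pos (by lia), show g - (g - k) = k by lia]
    exact (h.adj (by lia)).symm
  · rw [if_neg (by lia), if_pos (show g - k - 1 < g - k by lia),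
      show k + 1 + (g - k - 1) = g by lia]
    by_cases hgm : m ≤ g
    · obtain rfl : g = m := by lia
      rw [if_pos le_rfl, Nat.sub_self]
      exact hm.symm
    · rw [if_neg hgm, show m - (m - g - 1) = g + 1 by lia]
      exact (h.adj (by lia)).symm

/-- A 2-connected graph with at most one more edge than vertices is a cycle or a theta graph. -/
theorem TwoConnected.exists_isCycleGraph_or_isTheta (hG : TwoConnected G)
    (he : G.edgeSet.ncard ≤ Fintype.card V + 1) :
    (∃ m x, IsCycleGraph G m x ∧ Fintype.card V = m + 1) ∨
      ∃ l P a b, IsTheta G l P a b ∧ l 0 + l 1 + l 2 = Fintype.card V + 1 := by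
  have : Nonempty V := Fintype.card_pos_iff.1 (by have := hG.1; lia)
  obtain ⟨m, x, h, hmax⟩ := exists_longest_path G
  by_cases hm : G.Adj (x m) (x 0)
  · have hsurj := h.surj_of_adj hG hmax hm
    have hcard := h.card_eq hsurj
    have h3 := hG.1
    by_cases hch : ∃ k g, k + 2 ≤ g ∧ g ≤ m ∧ (k ≠ 0 ∨ g ≠ m) ∧ G.Adj (x k) (x g)
    · obtain ⟨k, g, h1, h2, h3, h4⟩ := hch
      exact Or.inr (exists_isTheta_of_chord hG he h hm h1 h2 h3 h4)
    · left
      have hx : ∀ k ≤ m, (if k ≤ m then x k else x 0) = x k := fun k hk ↦ if_pos hk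
      have key : ∀ {k g}, k ≤ m → g ≤ m → G.Adj (x k) (x g) →
          k + 1 = g ∨ g + 1 = k ∨ (k = 0 ∧ g = m) ∨ (g = 0 ∧ k = m) := by
        intro k g hk hg hadj
        have hne : k ≠ g := by
          rintro rfl
          exact hadj.ne rfl
        by_contra hcon
        rcases lt_or_gt_of_ne hne with hlt | hlt
        · exact hch ⟨k, g, by lia, hg, by lia, hadj⟩
        · exact hch ⟨g, k, by lia, hk, by lia, hadj.symm⟩
      refine ⟨m, fun k ↦ if k ≤ m then x k else x 0, ?_, hcard⟩
      refine ⟨⟨by lia, fun {s t} hs ht hh ↦ ?_, fun {s} hs ↦ ?_, by simp⟩,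
        fun {k y} h0 hk hadj ↦ ?_, fun {y} hadj ↦ ?_, fun v ↦ ?_⟩
      · rw [hx s hs, hx t ht] at hh
        exact h.inj hs ht hh
      · rw [hx s hs]
        split_ifs with h1
        · exact h.adj h1
        · rwa [show s = m by lia]
      · obtain ⟨g, hg, rfl⟩ := hsurj y
        rw [hx k hk] at hadj
        rw [hx (k - 1) (by lia)]
        rcases key hk hg hadj with rfl | rfl | ⟨rfl, _⟩ | ⟨rfl, rfl⟩
        · exact Or.inr (hx _ hg).symm
        · exact Or.inl rfl
        · exact absurd h0 (lt_irrefl _)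
        · right
          rw [if_neg (by lia)]
      · obtain ⟨g, hg, rfl⟩ := hsurj y
        rw [hx 0 (by lia)] at hadj
        rw [hx m le_rfl, hx 1 (by lia)]
        rcases key (Nat.zero_le m) hg hadj with rfl | h1 | ⟨_, rfl⟩ | ⟨_, h1⟩
        · exact Or.inr rfl
        · lia
        · exact Or.inl rfl
        · lia
      · obtain ⟨g, hg, rfl⟩ := hsurj v
        exact ⟨g, hg, (hx g hg).symm⟩
  · right
    obtain ⟨j, hj, hjm, h0j⟩ := h.exists_adj_start hG hmax
    obtain ⟨i, hi, him, hmi⟩ := h.reverse.exists_adj_start hG hmax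
    rw [Nat.sub_zero] at hmi
    have hjm' : j ≠ m := by
      rintro rfl
      exact hm h0j.symm
    have him' : i ≠ m := by
      rintro rfl
      rw [Nat.sub_self] at hmi
      exact hm hmi
    exact exists_isTheta_of_path hG he h hj (by lia) (i := m - i) (by lia) (by lia) h0j hmi

end Structure

theorem exists_rainbowTwoConnectedColouring {V : Type*} [Fintype V] {G : SimpleGraph V}
    (h : ∀ (r : ℕ) (col : Sym2 V → Fin r), Function.Injective col →
      RainbowTwoConnectedColouring G col) :
    ∃ col : Sym2 V → Fin (rc2 G), RainbowTwoConnectedColouring G col := by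
  classical
  exact Nat.sInf_mem (s := {r : ℕ | ∃ col : Sym2 V → Fin r, RainbowTwoConnectedColouring G col})
    ⟨_, _, h _ _ (Fintype.equivFin (Sym2 V)).injective⟩

theorem TwoConnected.card_le_rc2_add_one {V : Type*} [Fintype V] {G : SimpleGraph V}
    (hG : TwoConnected G) (hV : 6 ≤ Fintype.card V) (he : G.edgeSet.ncard ≤ Fintype.card V + 1) :
    Fintype.card V ≤ rc2 G + 1 := by
  rcases hG.exists_isCycleGraph_or_isTheta he with ⟨m, x, h, hm⟩ | ⟨l, P, a, b, h, hl⟩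
  · obtain ⟨col, hc⟩ := exists_rainbowTwoConnectedColouring fun _ _ ↦
      h.rainbowTwoConnectedColouring
    have := h.le hc
    lia
  · obtain ⟨col, hc⟩ := exists_rainbowTwoConnectedColouring fun _ _ ↦
      h.rainbowTwoConnectedColouring
    have hlong : ∃ t, 3 ≤ l t := by
      by_contra! hcon
      have h0 := hcon 0
      have h1 := hcon 1
      have h2 := hcon 2
      lia
    have := h.sum_le hlong hc
    lia

theorem exists_twoConnected_rc2_le {n : ℕ} (hn : 6 ≤ n) :
    ∃ G : SimpleGraph (Fin n), TwoConnected G ∧ rc2 G ≤ n - 2 ∧ G.edgeSet.ncard = n + 2 := by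
  obtain ⟨N, rfl⟩ : ∃ N, n = N + 4 := ⟨n - 4, by lia⟩
  have hc := fourThread_rainbow (N := N) (by lia)
  have hG : TwoConnected (fourThread N) :=
    twoConnected_of_rainbowTwoConnectedColouring (by rw [Fintype.card_fin]; lia) hc
  have hrc : rc2 (fourThread N) ≤ N + 2 := Nat.sInf_le ⟨_, hc⟩
  refine ⟨fourThread N, hG, by lia, ?_⟩
  have hle := fourThread_ncard_edgeSet_le (N := N)
  by_contra hne
  have := hG.card_le_rc2_add_one (by rw [Fintype.card_fin]; lia) (by rw [Fintype.card_fin]; lia)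
  rw [Fintype.card_fin] at this
  lia

/-- For n ≥ 6, t₂(n, n−2) = n + 2. -/
theorem stmt13 (n : ℕ) (hn : 6 ≤ n) : t2 n (n - 2) = n + 2 := by
  refine le_antisymm (Nat.sInf_le (exists_twoConnected_rc2_le hn)) ?_
  refine le_csInf ⟨_, exists_twoConnected_rc2_le hn⟩ ?_
  rintro _ ⟨G, hG, hrc, rfl⟩
  by_contra! hlt
  have := hG.card_le_rc2_add_one (by rwa [Fintype.card_fin]) (by rw [Fintype.card_fin]; lia)
  rw [Fintype.card_fin] at this
  lia
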